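/- Let X be a complex Banach space of dimension at least 2 and let J be a uniformly closed Jordan algebra of compact operators on X (a linear subspace of B(X), closed in the operator-norm topology, closed under the Jordan product {A,B} = AB + BA, all of whose elements are compact). If J contains no nonzero finite-rank nilpotent element (i.e. no nonzero F ∈ J of finite rank with Fᵏ = 0 for some k ≥ 1), then J is reducible: there exists a closed subspace M of X with M ≠ {0} and M ≠ X such that A(M) ⊆ M for every A ∈ J. -/

import Mathlib

open Filter Topology

/-- Circle integrals commute with continuous linear maps. -/
theorem ContinuousLinearMap.circleIntegral_map {E F : Type*} [NormedAddCommGroup E]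
    [NormedSpace ℂ E] [CompleteSpace E] [NormedAddCommGroup F] [NormedSpace ℂ F] [CompleteSpace F]
    (L : E →L[ℂ] F) {f : ℂ → E} {c : ℂ} {R : ℝ} (hR : 0 ≤ R)
    (hf : ContinuousOn f (Metric.sphere c R)) :
    (∮ z in C(c, R), L (f z)) = L (∮ z in C(c, R), f z) := by
  have h : IntervalIntegrable (fun θ => deriv (circleMap c R) θ • f (circleMap c R θ))
      MeasureTheory.volume 0 (2 * Real.pi) :=
    (hf.circleIntegrable hR).out
  rw [circleIntegral, circleIntegral, ← L.intervalIntegral_comp_comm h]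
  simp

theorem continuousOn_resolvent {𝒜 : Type*} [NormedRing 𝒜] [NormedAlgebra ℂ 𝒜] [CompleteSpace 𝒜]
    (a : 𝒜) : ContinuousOn (resolvent a) (resolventSet ℂ a) :=
  fun _ hz => (spectrum.hasDerivAt_resolvent_const_left hz).continuousAt.continuousWithinAt

theorem mul_resolvent_eq {𝒜 : Type*} [Ring 𝒜] [Algebra ℂ 𝒜]
    {a : 𝒜} {z : ℂ} (hz : z ∈ resolventSet ℂ a) : a * resolvent a z = z • resolvent a z - 1 := by
  have h : (algebraMap ℂ 𝒜 z - a) * resolvent a z = 1 := Ring.mul_inverse_cancel _ hz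
  rw [sub_mul, Algebra.algebraMap_eq_smul_one, smul_mul_assoc, one_mul] at h
  rw [← h]; abel

theorem resolvent_mul_eq {𝒜 : Type*} [Ring 𝒜] [Algebra ℂ 𝒜]
    {a : 𝒜} {z : ℂ} (hz : z ∈ resolventSet ℂ a) : resolvent a z * a = z • resolvent a z - 1 := by
  have h : resolvent a z * (algebraMap ℂ 𝒜 z - a) = 1 := Ring.inverse_mul_cancel _ hz
  rw [mul_sub, Algebra.algebraMap_eq_smul_one, mul_smul_comm, mul_one] at h
  rw [← h]; abel

/-- The moment `(2πi)⁻¹ ∮ zᵐ (z - a)⁻¹ dz` of the resolvent over the circle `|z| = R`. -/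
noncomputable def circleMoment {𝒜 : Type*} [NormedRing 𝒜] [NormedAlgebra ℂ 𝒜]
    (a : 𝒜) (R : ℝ) (m : ℤ) : 𝒜 :=
  (2 * Real.pi * Complex.I : ℂ)⁻¹ • ∮ z in C(0, R), z ^ m • resolvent a z

section
variable {𝒜 : Type*} [NormedRing 𝒜] [NormedAlgebra ℂ 𝒜] [CompleteSpace 𝒜] {a : 𝒜} {R : ℝ}

theorem continuousOn_zpow_smul_resolvent (hR : 0 < R)
    (ha : Metric.sphere 0 R ⊆ resolventSet ℂ a) (m : ℤ) :
    ContinuousOn (fun z : ℂ => z ^ m • resolvent a z) (Metric.sphere 0 R) := by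
  refine ContinuousOn.smul (fun z hz => ?_) ((continuousOn_resolvent a).mono ha)
  refine (continuousAt_zpow₀ z m (Or.inl ?_)).continuousWithinAt
  rintro rfl
  simp at hz
  exact hR.ne hz

theorem circleMoment_bound (hR : 0 < R) (ha : Metric.sphere 0 R ⊆ resolventSet ℂ a) :
    ∃ C : ℝ, 0 < C ∧ ∀ m : ℤ, ‖circleMoment a R m‖ ≤ C * R ^ m := by
  obtain ⟨C, hC⟩ := (isCompact_sphere (0 : ℂ) R).exists_bound_of_continuousOn
    ((continuousOn_resolvent a).mono ha)
  refine ⟨R * (|C| + 1), by positivity, fun m => ?_⟩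
  have := circleIntegral.norm_two_pi_i_inv_smul_integral_le_of_norm_le_const
    (f := fun z : ℂ => z ^ m • resolvent a z) (c := 0) (C := R ^ m * (|C| + 1)) hR.le (by
      intro z hz
      have h1 : ‖z‖ = R := by simpa using hz
      rw [norm_smul, norm_zpow, h1]
      gcongr
      linarith [hC z hz, le_abs_self C])
  refine this.trans_eq (by ring)

theorem map_circleMoment {F : Type*} [NormedAddCommGroup F] [NormedSpace ℂ F] [CompleteSpace F]
    (L : 𝒜 →L[ℂ] F) (hR : 0 < R) (ha : Metric.sphere 0 R ⊆ resolventSet ℂ a) (m : ℤ) :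
    L (circleMoment a R m) =
      (2 * Real.pi * Complex.I : ℂ)⁻¹ • ∮ z in C(0, R), z ^ m • L (resolvent a z) := by
  rw [circleMoment, map_smul,
    ← L.circleIntegral_map hR.le (continuousOn_zpow_smul_resolvent hR ha m)]
  simp

theorem two_pi_I_inv_smul_circleIntegral_zpow (hR : 0 < R) (m : ℤ) :
    (2 * Real.pi * Complex.I : ℂ)⁻¹ • (∮ z in C(0, R), z ^ m • (1 : 𝒜)) =
      if m = -1 then 1 else 0 := by
  rw [circleIntegral.integral_smul_const]
  split_ifs with h
  · subst h
    have := circleIntegral.integral_sub_center_inv 0 hR.ne'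
    simp only [sub_zero] at this
    simp only [zpow_neg, zpow_one]
    rw [this, smul_smul, inv_mul_cancel₀ Complex.two_pi_I_ne_zero, one_smul]
  · have := circleIntegral.integral_sub_zpow_of_ne h 0 0 R
    simp only [sub_zero] at this
    rw [this]; simp

theorem mul_circleMoment_aux (hR : 0 < R) (m : ℤ) (f : ℂ → 𝒜)
    (ha : Metric.sphere 0 R ⊆ resolventSet ℂ a)
    (hf : ∀ z ∈ resolventSet ℂ a, f z = z • resolvent a z - 1) :
    (2 * Real.pi * Complex.I : ℂ)⁻¹ • (∮ z in C(0, R), z ^ m • f z) =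
      circleMoment a R (m + 1) - if m = -1 then 1 else 0 := by
  rw [← two_pi_I_inv_smul_circleIntegral_zpow (𝒜 := 𝒜) hR m, circleMoment, ← smul_sub,
    ← circleIntegral.integral_sub]
  · congr 1
    refine circleIntegral.integral_congr hR.le fun z hz => ?_
    have hz0 : z ≠ 0 := by
      rintro rfl
      simp at hz
      exact hR.ne hz
    rw [hf z (ha hz), smul_sub, smul_smul, zpow_add_one₀ hz0]
  · exact (continuousOn_zpow_smul_resolvent hR ha _).circleIntegrable hR.le
  · refine ContinuousOn.circleIntegrable hR.le fun z hz => ?_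
    refine ((continuousAt_zpow₀ z m (Or.inl ?_)).smul continuousAt_const).continuousWithinAt
    rintro rfl
    simp at hz
    exact hR.ne hz

theorem mul_circleMoment (hR : 0 < R) (ha : Metric.sphere 0 R ⊆ resolventSet ℂ a) (m : ℤ) :
    a * circleMoment a R m = circleMoment a R (m + 1) - if m = -1 then 1 else 0 := by
  rw [← mul_circleMoment_aux hR m (fun z => a * resolvent a z) ha fun z hz => mul_resolvent_eq hz]
  exact map_circleMoment (ContinuousLinearMap.mul ℂ 𝒜 a) hR ha m

theorem circleMoment_mul (hR : 0 < R) (ha : Metric.sphere 0 R ⊆ resolventSet ℂ a) (m : ℤ) :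
    circleMoment a R m * a = circleMoment a R (m + 1) - if m = -1 then 1 else 0 := by
  rw [← mul_circleMoment_aux hR m (fun z => resolvent a z * a) ha fun z hz => resolvent_mul_eq hz]
  exact map_circleMoment ((ContinuousLinearMap.mul ℂ 𝒜).flip a) hR ha m

theorem commute_circleMoment (hR : 0 < R) (ha : Metric.sphere 0 R ⊆ resolventSet ℂ a) (m : ℤ) :
    Commute a (circleMoment a R m) :=
  (mul_circleMoment hR ha m).trans (circleMoment_mul hR ha m).symm

theorem pow_mul_circleMoment_zero (hR : 0 < R) (ha : Metric.sphere 0 R ⊆ resolventSet ℂ a)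
    (n : ℕ) : a ^ n * circleMoment a R 0 = circleMoment a R n := by
  induction n with
  | zero => simp
  | succ n ih =>
    rw [pow_succ', mul_assoc, ih, mul_circleMoment hR ha, if_neg (by omega)]
    simp

theorem one_sub_circleMoment_zero (hR : 0 < R) (ha : Metric.sphere 0 R ⊆ resolventSet ℂ a)
    (n : ℕ) : 1 - circleMoment a R 0 = -(a ^ (n + 1) * circleMoment a R (-(n + 1 : ℕ))) := by
  induction n with
  | zero => simp [mul_circleMoment hR ha]
  | succ n ih =>
    rw [ih, pow_succ _ (n + 1), mul_assoc, mul_circleMoment hR ha, if_neg (by omega)]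
    push_cast
    simp
end

/-- A compact operator has only finitely many eigenvalues outside a disc around zero. -/
theorem IsCompactOperator.finite_setOf_hasEigenvalue {X : Type*} [NormedAddCommGroup X]
    [NormedSpace ℂ X] {K : X →L[ℂ] X} (hK : IsCompactOperator K) {ε : ℝ} (hε : 0 < ε) :
    {μ : ℂ | ε ≤ ‖μ‖ ∧ Module.End.HasEigenvalue (K : Module.End ℂ X) μ}.Finite := by
  by_contra hinf
  let s : ℕ ↪ _ := Set.Infinite.natEmbedding _ hinf
  let μ : ℕ → ℂ := fun n => (s n : ℂ)
  have hμ : ∀ n, ε ≤ ‖μ n‖ := fun n => (s n).2.1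
  choose x hx using fun n => (s n).2.2.exists_hasEigenvector
  have hinj : Function.Injective μ := Subtype.val_injective.comp s.injective
  have hli : LinearIndependent ℂ x :=
    Module.End.eigenvectors_linearIndependent' (K : Module.End ℂ X) μ hinj x hx
  have hKx : ∀ n, K (x n) = μ n • x n := fun n => (hx n).apply_eq_smul
  let V : ℕ → Submodule ℂ X := fun n => Submodule.span ℂ (x '' Set.Iio n)
  have hVmono : Monotone V := fun m n h =>
    Submodule.span_mono (Set.image_mono (Set.Iio_subset_Iio h))
  have hVfin : ∀ n, FiniteDimensional ℂ (V n) := fun n =>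
    FiniteDimensional.span_of_finite ℂ ((Set.finite_Iio n).image x)
  have hKV : ∀ n, ∀ y ∈ V n, K y ∈ V n := by
    intro n y hy
    induction hy using Submodule.span_induction with
    | mem y hy =>
      obtain ⟨i, hi, rfl⟩ := hy
      rw [hKx]
      exact Submodule.smul_mem _ _ (Submodule.subset_span ⟨i, hi, rfl⟩)
    | zero => simp
    | add a b _ _ ha hb => rw [map_add]; exact add_mem ha hb
    | smul c a _ ha => rw [map_smul]; exact Submodule.smul_mem _ _ ha
  have hKμ : ∀ n, ∀ y ∈ V (n + 1), K y - μ n • y ∈ V n := by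
    intro n y hy
    induction hy using Submodule.span_induction with
    | mem y hy =>
      obtain ⟨i, hi, rfl⟩ := hy
      rcases (Nat.lt_succ_iff.1 hi).lt_or_eq with h | rfl
      · have : x i ∈ V n := Submodule.subset_span ⟨i, h, rfl⟩
        exact sub_mem (hKV n _ this) (Submodule.smul_mem _ _ this)
      · simp [hKx]
    | zero => simp
    | add a b _ _ ha hb =>
      have := add_mem ha hb
      rw [map_add, smul_add]
      convert this using 1
      abel
    | smul c a _ ha =>
      rw [map_smul, smul_comm, ← smul_sub]
      exact Submodule.smul_mem _ _ ha
  have hy : ∀ n, ∃ y ∈ V (n + 1), ‖y‖ ≤ 3 ∧ ∀ z ∈ V n, 1 ≤ ‖y - z‖ := by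
    intro n
    have h1 : IsClosed ((V n).comap (V (n + 1)).subtype : Set (V (n + 1))) :=
      (Submodule.closed_of_finiteDimensional (V n)).preimage continuous_subtype_val
    have h2 : ∃ y : V (n + 1), y ∉ (V n).comap (V (n + 1)).subtype := by
      refine ⟨⟨x n, Submodule.subset_span ⟨n, by simp, rfl⟩⟩, ?_⟩
      exact hli.notMem_span_image (s := Set.Iio n) (by simp)
    obtain ⟨⟨y, hy⟩, hy3, hyz⟩ := riesz_lemma_of_norm_lt (c := (2 : ℂ)) (R := 3)
      (by simp) (by norm_num) h1 h2
    exact ⟨y, hy, hy3, fun z hz => hyz ⟨z, hVmono n.le_succ hz⟩ hz⟩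
  choose y hyV hy3 hyz using hy
  have hsep : ∀ m n, m < n → ε ≤ ‖K (y n) - K (y m)‖ := by
    intro m n hmn
    have hn0 : μ n ≠ 0 := fun h => by have := hμ n; rw [h, norm_zero] at this; linarith
    have hmem : K (y m) - (K (y n) - μ n • y n) ∈ V n :=
      sub_mem (hVmono hmn (hKV _ _ (hyV m))) (hKμ n _ (hyV n))
    have h1 := hyz n _ (Submodule.smul_mem _ (μ n)⁻¹ hmem)
    have h2 : K (y n) - K (y m) =
        μ n • (y n - (μ n)⁻¹ • (K (y m) - (K (y n) - μ n • y n))) := by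
      rw [smul_sub, smul_smul, mul_inv_cancel₀ hn0, one_smul]; abel
    rw [h2, norm_smul]
    nlinarith [hμ n]
  obtain ⟨C, hC, hKC⟩ := hK.image_closedBall_subset_compact 3
  obtain ⟨w, -, φ, hφ, hlim⟩ := hC.tendsto_subseq (x := fun n => K (y n))
    (fun n => hKC ⟨y n, by simpa using hy3 n, rfl⟩)
  obtain ⟨N, hN⟩ := Metric.cauchySeq_iff.1 hlim.cauchySeq ε hε
  have := hN (N + 1) (by simp) N le_rfl
  rw [dist_eq_norm] at this
  exact absurd this (not_lt.2 (hsep _ _ (hφ N.lt_succ_self)))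

theorem IsCompactOperator.countable_spectrum {X : Type*} [NormedAddCommGroup X]
    [NormedSpace ℂ X] [CompleteSpace X] {K : X →L[ℂ] X} (hK : IsCompactOperator K) :
    (spectrum ℂ K).Countable := by
  refine Set.Countable.mono (s₂ := {0} ∪ ⋃ n : ℕ, {μ : ℂ | 1 / ((n : ℝ) + 1) ≤ ‖μ‖ ∧
    Module.End.HasEigenvalue (K : Module.End ℂ X) μ}) ?_ ((Set.countable_singleton _).union
      (Set.countable_iUnion fun n =>
        (hK.finite_setOf_hasEigenvalue (by positivity)).countable))
  intro μ hμ
  by_cases h0 : μ = 0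
  · exact Or.inl h0
  obtain ⟨n, hn⟩ := exists_nat_one_div_lt (norm_pos_iff.2 h0)
  exact Or.inr (Set.mem_iUnion.2 ⟨n, hn.le, (hK.hasEigenvalue_iff_mem_spectrum h0).2 hμ⟩)

/-- A countable subset of the plane misses a circle in every annulus. -/
theorem Set.Countable.exists_sphere_subset_compl {s : Set ℂ} (hs : s.Countable) {a b : ℝ}
    (hab : a < b) : ∃ R, a < R ∧ R < b ∧ Metric.sphere 0 R ⊆ sᶜ := by
  have h1 : ((fun z : ℂ => ‖z‖) '' s).Countable := hs.image _
  have h2 : ¬ (Set.Ioo a b).Countable := by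
    intro h
    have := Cardinal.mk_Ioo_real hab
    rw [← Cardinal.le_aleph0_iff_set_countable, this] at h
    exact absurd h (not_le.2 Cardinal.aleph0_lt_continuum)
  obtain ⟨R, hR, hRs⟩ := Set.not_subset.1 fun h => h2 (h1.mono h)
  refine ⟨R, hR.1, hR.2, fun z hz hzs => hRs ⟨z, hzs, by simpa using hz⟩⟩

/-- The fixed space of a compact operator is finite dimensional. -/
theorem IsCompactOperator.finiteDimensional_of_fixed {X : Type*} [NormedAddCommGroup X]
    [NormedSpace ℂ X] {K : X →L[ℂ] X} (hK : IsCompactOperator K) (V : Submodule ℂ X)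
    (hV : ∀ x ∈ V, K x = x) : FiniteDimensional ℂ V := by
  let W : Submodule ℂ X := LinearMap.ker ((1 - K : X →L[ℂ] X) : X →ₗ[ℂ] X)
  have hWmem : ∀ x, x ∈ W ↔ K x = x := fun x => by
    change x - K x = 0 ↔ _
    rw [sub_eq_zero, eq_comm]
  have hWc : IsClosed (W : Set X) := (1 - K : X →L[ℂ] X).isClosed_ker
  have hmaps : ∀ x ∈ W, (K : X →ₗ[ℂ] X) x ∈ W := fun x hx => by
    have h := (hWmem x).1 hx
    rw [ContinuousLinearMap.coe_coe, h]; exact hx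
  have h1 : IsCompactOperator ((K : X →ₗ[ℂ] X).restrict hmaps) :=
    IsCompactOperator.restrict (f := (K : X →ₗ[ℂ] X)) hK hmaps hWc
  have h2 : ((K : X →ₗ[ℂ] X).restrict hmaps : W → W) = id := by
    ext x
    exact (hWmem x).1 x.2
  rw [h2] at h1
  have h3 : FiniteDimensional ℂ W := FiniteDimensional.of_isCompactOperator_id h1
  exact Submodule.finiteDimensional_of_le fun x hx => (hWmem x).2 (hV x hx)

/-- Spectral truncation: a compact operator is, up to a finite-rank operator, of growth rate `ε`. -/
theorem IsCompactOperator.exists_finiteRank_truncation {X : Type*} [NormedAddCommGroup X]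
    [NormedSpace ℂ X] [CompleteSpace X] {K : X →L[ℂ] X} (hK : IsCompactOperator K) {ε : ℝ}
    (hε : 0 < ε) : ∃ P : X →L[ℂ] X, FiniteDimensional ℂ (LinearMap.range (P : X →ₗ[ℂ] X)) ∧
      ∃ C : ℝ, 0 < C ∧ ∀ n : ℕ, ‖K ^ n * (1 - P)‖ ≤ C * ε ^ n ∧ ‖(1 - P) * K ^ n‖ ≤ C * ε ^ n := by
  obtain ⟨r, hr0, hrε, hr⟩ := hK.countable_spectrum.exists_sphere_subset_compl
    (half_lt_self hε)
  obtain ⟨q, hq0, hqr, hq⟩ := hK.countable_spectrum.exists_sphere_subset_compl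
    (half_pos hε)
  have hq' : 0 < q := hq0
  have hr' : 0 < r := (half_pos hε).trans hr0
  have hsub : ∀ {s : Set ℂ}, s ⊆ (spectrum ℂ K)ᶜ → s ⊆ resolventSet ℂ K := fun h z hz => by
    have := h hz
    rwa [spectrum, compl_compl] at this
  replace hr := hsub hr
  replace hq := hsub hq
  obtain ⟨C, hC0, hC⟩ := circleMoment_bound hr' hr
  obtain ⟨D, hD0, hD⟩ := circleMoment_bound hq' hq
  have hlt : q < r := hqr.trans hr0
  refine ⟨1 - circleMoment K r 0, ?_, C, hC0, fun n => ?_⟩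
  · have hprod : circleMoment K q 0 * (1 - circleMoment K r 0) = 0 := by
      have hb : ∀ n : ℕ, ‖circleMoment K q 0 * (1 - circleMoment K r 0)‖ ≤
          D * C * (q / r) ^ (n + 1) := fun n => by
        have hcomm : circleMoment K q 0 * K ^ (n + 1) = circleMoment K q (n + 1 : ℕ) := by
          rw [← pow_mul_circleMoment_zero hq' hq,
            ((commute_circleMoment hq' hq 0).pow_left (n + 1)).eq]
        rw [one_sub_circleMoment_zero hr' hr n, mul_neg, norm_neg, ← mul_assoc, hcomm]
        refine (norm_mul_le _ _).trans ?_
        refine (mul_le_mul (hD _) (hC _) (norm_nonneg _) (by positivity)).trans_eq ?_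
        rw [div_pow, zpow_neg, zpow_natCast, zpow_natCast, div_eq_mul_inv]; ring
      have hlim : Tendsto (fun n : ℕ => D * C * (q / r) ^ (n + 1)) atTop (𝓝 (D * C * 0)) :=
        ((tendsto_pow_atTop_nhds_zero_of_lt_one (by positivity)
          ((div_lt_one hr').2 hlt)).comp (tendsto_add_atTop_nat 1)).const_mul _
      rw [mul_zero] at hlim
      exact norm_le_zero_iff.1 (ge_of_tendsto' hlim hb)
    have hcpt : IsCompactOperator (1 - circleMoment K q 0 : X →L[ℂ] X) := by
      rw [one_sub_circleMoment_zero hq' hq 0, zero_add, pow_one]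
      exact (hK.comp_clm (circleMoment K q _)).neg
    refine hcpt.finiteDimensional_of_fixed _ ?_
    rintro _ ⟨x, rfl⟩
    have h0 : circleMoment K q 0 ((1 - circleMoment K r 0) x) = 0 := DFunLike.congr_fun hprod x
    change (1 - circleMoment K r 0) x - circleMoment K q 0 ((1 - circleMoment K r 0) x) = _
    rw [h0, sub_zero]
    rfl
  · rw [sub_sub_cancel, ← ((commute_circleMoment hr' hr 0).pow_left n).eq, and_self,
      pow_mul_circleMoment_zero hr' hr n]
    refine (hC n).trans ?_
    rw [zpow_natCast]
    gcongr

theorem spectrum_mul_subset_of_comm {A : Type*} [NormedCommRing A] [NormedAlgebra ℂ A]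
    [CompleteSpace A] (a b : A) {μ : ℂ} (hμ : μ ∈ spectrum ℂ (a * b)) :
    ∃ α ∈ spectrum ℂ a, ∃ β ∈ spectrum ℂ b, α * β = μ := by
  obtain ⟨f, hf⟩ := WeakDual.CharacterSpace.mem_spectrum_iff_exists.1 hμ
  exact ⟨f a, AlgHom.apply_mem_spectrum f a, f b, AlgHom.apply_mem_spectrum f b,
    by rw [← hf, map_mul]⟩

/-- The spectrum of a product of commuting elements of a complex Banach algebra. -/
theorem Commute.exists_mul_eq_of_mem_spectrum {𝒜 : Type*} [NormedRing 𝒜] [NormedAlgebra ℂ 𝒜]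
    [CompleteSpace 𝒜] {a b : 𝒜} (hab : Commute a b) {μ : ℂ} (hμ : μ ∈ spectrum ℂ (a * b)) :
    ∃ α ∈ spectrum ℂ a, ∃ β ∈ spectrum ℂ b, α * β = μ := by
  let C : Set 𝒜 := Set.centralizer {a, b}
  let S : Subalgebra ℂ 𝒜 := Subalgebra.centralizer ℂ C
  have haC : a ∈ C := by
    rintro x (rfl | rfl)
    · rfl
    · exact hab.symm
  have hbC : b ∈ C := by
    rintro x (rfl | rfl)
    · exact hab
    · rfl
  have haS : a ∈ S := fun c hc => (hc a (by simp)).symm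
  have hbS : b ∈ S := fun c hc => (hc b (by simp)).symm
  have hSC : ∀ s ∈ S, s ∈ C := fun s hs => by
    rintro x (rfl | rfl)
    · exact hs _ haC
    · exact hs _ hbC
  have hclosed : IsClosed (S : Set 𝒜) := Set.isClosed_centralizer C
  have : CompleteSpace S := hclosed.completeSpace_coe
  let _ : NormedCommRing S :=
    { (inferInstance : NormedRing S) with
      mul_comm := fun x y => Subtype.ext (y.2 _ (hSC _ x.2)) }
  have hspec : ∀ x : S, spectrum ℂ x = spectrum ℂ (x : 𝒜) := by
    intro x
    ext z
    rw [spectrum.mem_iff, spectrum.mem_iff, not_iff_not]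
    have hcoe : (algebraMap ℂ 𝒜 z - x : 𝒜) = ((algebraMap ℂ S z - x : S) : 𝒜) := rfl
    rw [hcoe]
    generalize algebraMap ℂ S z - x = y
    refine ⟨fun h => h.map S.val, fun h => ?_⟩
    obtain ⟨u, hu⟩ := h
    have hinv : (↑u⁻¹ : 𝒜) ∈ S := fun c hc => by
      have h1 : Commute c (u : 𝒜) := by rw [hu]; exact y.2 c hc
      exact h1.units_inv_right.eq
    refine ⟨⟨y, ⟨_, hinv⟩, ?_, ?_⟩, rfl⟩
    · exact Subtype.ext (by change (y : 𝒜) * ↑u⁻¹ = 1; rw [← hu, u.mul_inv])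
    · exact Subtype.ext (by change (↑u⁻¹ : 𝒜) * y = 1; rw [← hu, u.inv_mul])
  obtain ⟨α, hα, β, hβ, h⟩ := spectrum_mul_subset_of_comm (⟨a, haS⟩ : S) ⟨b, hbS⟩ (μ := μ)
    ((hspec (⟨a, haS⟩ * ⟨b, hbS⟩)).symm ▸ hμ)
  rw [hspec] at hα hβ
  exact ⟨α, hα, β, hβ, h⟩

theorem Commute.countable_spectrum_mul {𝒜 : Type*} [NormedRing 𝒜] [NormedAlgebra ℂ 𝒜]
    [CompleteSpace 𝒜] {a b : 𝒜} (hab : Commute a b) (ha : (spectrum ℂ a).Countable)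
    (hb : (spectrum ℂ b).Countable) : (spectrum ℂ (a * b)).Countable := by
  refine (ha.image2 hb (· * ·)).mono fun μ hμ => ?_
  obtain ⟨α, hα, β, hβ, h⟩ := hab.exists_mul_eq_of_mem_spectrum hμ
  exact ⟨α, hα, β, hβ, h⟩

/-- Left multiplication, as an operator on a Banach algebra, has no new spectrum. -/
theorem spectrum_mulLeft_subset {𝒜 : Type*} [NormedRing 𝒜] [NormedAlgebra ℂ 𝒜] (a : 𝒜) :
    spectrum ℂ (ContinuousLinearMap.mul ℂ 𝒜 a) ⊆ spectrum ℂ a := by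
  intro z hz
  contrapose! hz
  rw [spectrum.notMem_iff] at hz ⊢
  obtain ⟨u, hu⟩ := hz
  have hsub : ∀ x, (algebraMap ℂ (𝒜 →L[ℂ] 𝒜) z - ContinuousLinearMap.mul ℂ 𝒜 a) x = u * x := by
    intro x
    rw [hu, sub_mul, Algebra.algebraMap_eq_smul_one, Algebra.algebraMap_eq_smul_one]
    simp
  refine ⟨⟨_, ContinuousLinearMap.mul ℂ 𝒜 ↑u⁻¹, ?_, ?_⟩, rfl⟩
  · ext x
    change (algebraMap ℂ (𝒜 →L[ℂ] 𝒜) z - ContinuousLinearMap.mul ℂ 𝒜 a) (↑u⁻¹ * x) = x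
    rw [hsub, u.mul_inv_cancel_left]
  · ext x
    change ↑u⁻¹ * (algebraMap ℂ (𝒜 →L[ℂ] 𝒜) z - ContinuousLinearMap.mul ℂ 𝒜 a) x = x
    rw [hsub, u.inv_mul_cancel_left]

theorem spectrum_mulRight_subset {𝒜 : Type*} [NormedRing 𝒜] [NormedAlgebra ℂ 𝒜] (a : 𝒜) :
    spectrum ℂ ((ContinuousLinearMap.mul ℂ 𝒜).flip a) ⊆ spectrum ℂ a := by
  intro z hz
  contrapose! hz
  rw [spectrum.notMem_iff] at hz ⊢
  obtain ⟨u, hu⟩ := hz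
  have hsub : ∀ x, (algebraMap ℂ (𝒜 →L[ℂ] 𝒜) z - (ContinuousLinearMap.mul ℂ 𝒜).flip a) x =
      x * u := by
    intro x
    rw [hu, mul_sub, Algebra.algebraMap_eq_smul_one, Algebra.algebraMap_eq_smul_one]
    simp
  refine ⟨⟨_, (ContinuousLinearMap.mul ℂ 𝒜).flip ↑u⁻¹, ?_, ?_⟩, rfl⟩
  · ext x
    change (algebraMap ℂ (𝒜 →L[ℂ] 𝒜) z - (ContinuousLinearMap.mul ℂ 𝒜).flip a) (x * ↑u⁻¹) = x
    rw [hsub, u.inv_mul_cancel_right]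
  · ext x
    change (algebraMap ℂ (𝒜 →L[ℂ] 𝒜) z - (ContinuousLinearMap.mul ℂ 𝒜).flip a) x * ↑u⁻¹ = x
    rw [hsub, u.mul_inv_cancel_right]

theorem countable_spectrum_add_smul_one {𝒜 : Type*} [Ring 𝒜] [Algebra ℂ 𝒜] {a : 𝒜}
    (ha : (spectrum ℂ a).Countable) (ν : ℂ) : (spectrum ℂ (ν • 1 + a)).Countable := by
  rw [← Algebra.algebraMap_eq_smul_one, ← spectrum.singleton_add_eq, Set.singleton_add]
  exact ha.image _

theorem IsCompactOperator.smul_one_sub_pow {X : Type*} [NormedAddCommGroup X] [NormedSpace ℂ X]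
    {k : X →L[ℂ] X} (hk : IsCompactOperator k) (ν : ℂ) (n : ℕ) :
    IsCompactOperator (ν ^ n • 1 - (ν • 1 + k) ^ n : X →L[ℂ] X) := by
  induction n with
  | zero => simpa using isCompactOperator_zero
  | succ n ih =>
    have h : (ν ^ (n + 1) • 1 - (ν • 1 + k) ^ (n + 1) : X →L[ℂ] X) =
        ν • (ν ^ n • 1 - (ν • 1 + k) ^ n) - (ν • 1 + k) ^ n * k := by
      rw [pow_succ (ν • (1 : X →L[ℂ] X) + k), mul_add, smul_sub, smul_smul, pow_succ' ν,
        mul_smul_comm, mul_one]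
      abel
    rw [h]
    exact (ih.smul ν).sub (hk.clm_comp _)

/-- The spectral projection of `ν + k`, with `k` compact, onto a disc not containing `ν`
is compact. -/
theorem IsCompactOperator.circleMoment_zero {X : Type*} [NormedAddCommGroup X] [NormedSpace ℂ X]
    [CompleteSpace X] {k : X →L[ℂ] X} (hk : IsCompactOperator k) {ν : ℂ} {R : ℝ} (hR : 0 < R)
    (hν : R < ‖ν‖) (ha : Metric.sphere 0 R ⊆ resolventSet ℂ (ν • 1 + k)) :
    IsCompactOperator (circleMoment (ν • 1 + k) R 0 : X →L[ℂ] X) := by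
  set h := ν • 1 + k with hh
  set A := circleMoment h R 0 with hA
  have hν0 : ν ≠ 0 := norm_pos_iff.1 (hR.trans hν)
  obtain ⟨C, hC0, hC⟩ := circleMoment_bound hR ha
  refine isCompactOperator_of_tendsto (l := atTop)
    (F := fun n : ℕ => (ν ^ n)⁻¹ • ((ν ^ n • 1 - h ^ n) * A)) (f := A) ?_
    (Eventually.of_forall fun n => ((hk.smul_one_sub_pow ν n).comp_clm A).smul _)
  have heq : ∀ n : ℕ, (ν ^ n)⁻¹ • ((ν ^ n • 1 - h ^ n) * A) - A =
      -((ν ^ n)⁻¹ • circleMoment h R n) := fun n => by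
    rw [sub_mul, hA, pow_mul_circleMoment_zero hR ha, smul_sub, smul_mul_assoc, one_mul, smul_smul,
      inv_mul_cancel₀ (pow_ne_zero n hν0), one_smul]
    abel
  rw [tendsto_iff_norm_sub_tendsto_zero]
  have hlim : Tendsto (fun n : ℕ => C * (R / ‖ν‖) ^ n) atTop (𝓝 (C * 0)) :=
    (tendsto_pow_atTop_nhds_zero_of_lt_one (by positivity)
      ((div_lt_one (hR.trans hν)).2 hν)).const_mul C
  rw [mul_zero] at hlim
  refine squeeze_zero (fun n => norm_nonneg _) (fun n => ?_) hlim
  rw [heq, norm_neg, norm_smul, norm_inv, norm_pow, div_pow, div_eq_inv_mul, mul_left_comm]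
  gcongr
  simpa using hC n

theorem finiteDimensional_range_of_truncation {X : Type*} [NormedAddCommGroup X] [NormedSpace ℂ X]
    {P Q y : X →L[ℂ] X} (hP : FiniteDimensional ℂ (LinearMap.range (P : X →ₗ[ℂ] X)))
    (hQ : FiniteDimensional ℂ (LinearMap.range (Q : X →ₗ[ℂ] X)))
    (h : (1 - P) * y * (1 - Q) = 0) :
    FiniteDimensional ℂ (LinearMap.range (y : X →ₗ[ℂ] X)) := by
  have : FiniteDimensional ℂ (LinearMap.range (P : X →ₗ[ℂ] X) ⊔
      (LinearMap.range (Q : X →ₗ[ℂ] X)).map (y : X →ₗ[ℂ] X) : Submodule ℂ X) := inferInstance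
  refine Submodule.finiteDimensional_of_le (S₂ := LinearMap.range (P : X →ₗ[ℂ] X) ⊔
      (LinearMap.range (Q : X →ₗ[ℂ] X)).map (y : X →ₗ[ℂ] X)) ?_
  rintro _ ⟨x, rfl⟩
  have hy : y x - y (Q x) - P (y x - y (Q x)) = 0 := by
    have := DFunLike.congr_fun h x
    change y (x - Q x) - P (y (x - Q x)) = 0 at this
    rwa [map_sub] at this
  have hy' : y x = P (y x - y (Q x)) + y (Q x) := by
    rw [← sub_eq_zero, ← hy]; abel
  change y x ∈ _
  rw [hy']
  exact Submodule.add_mem_sup ⟨_, rfl⟩ ⟨_, ⟨x, rfl⟩, rfl⟩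

theorem norm_truncated_pow_le {𝒜 : Type*} [NormedRing 𝒜] [NormedAlgebra ℂ 𝒜] {c d p q : 𝒜}
    {C D ε : ℝ} (hD0 : 0 ≤ D) (hC0 : 0 ≤ C) (hε : 0 < ε) (hε1 : ε ≤ 1)
    (hC : ∀ n : ℕ, ‖p * c ^ n‖ ≤ C * ε ^ n) (hD : ∀ n : ℕ, ‖d ^ n * q‖ ≤ D * ε ^ n)
    {T : 𝒜 → 𝒜} (hT : ∀ x, T x = c * x + x * d + c * x * d) (x : 𝒜) (n i j : ℕ) :
    ‖p * c ^ i * T^[n] x * (d ^ j * q)‖ ≤ C * D * ε ^ (i + j) * (3 * ε) ^ n * ‖x‖ := by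
  induction n generalizing i j with
  | zero =>
    calc ‖p * c ^ i * T^[0] x * (d ^ j * q)‖ ≤ ‖p * c ^ i‖ * ‖x‖ * ‖d ^ j * q‖ :=
          (norm_mul_le _ _).trans (mul_le_mul_of_nonneg_right (norm_mul_le _ _) (norm_nonneg _))
      _ ≤ (C * ε ^ i) * ‖x‖ * (D * ε ^ j) := by
          gcongr
          · exact hC i
          · exact hD j
      _ = _ := by ring
  | succ n ih =>
    set u := T^[n] x with hu
    have hstep : p * c ^ i * T^[n + 1] x * (d ^ j * q) =
        p * c ^ (i + 1) * u * (d ^ j * q) + p * c ^ i * u * (d ^ (j + 1) * q) +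
          p * c ^ (i + 1) * u * (d ^ (j + 1) * q) := by
      rw [Function.iterate_succ_apply', ← hu, hT, pow_succ c, pow_succ' d]
      noncomm_ring
    rw [hstep]
    have h1 := ih (i + 1) j
    have h2 := ih i (j + 1)
    have h3 := ih (i + 1) (j + 1)
    refine (norm_add₃_le).trans ((add_le_add_three h1 h2 h3).trans ?_)
    have hk : 0 ≤ C * D * ε ^ (i + j) * (3 * ε) ^ n * ‖x‖ := by positivity
    have e1 : C * D * ε ^ (i + 1 + j) * (3 * ε) ^ n * ‖x‖ =
        C * D * ε ^ (i + j) * (3 * ε) ^ n * ‖x‖ * ε := by ring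
    have e2 : C * D * ε ^ (i + (j + 1)) * (3 * ε) ^ n * ‖x‖ =
        C * D * ε ^ (i + j) * (3 * ε) ^ n * ‖x‖ * ε := by ring
    have e3 : C * D * ε ^ (i + 1 + (j + 1)) * (3 * ε) ^ n * ‖x‖ =
        C * D * ε ^ (i + j) * (3 * ε) ^ n * ‖x‖ * (ε * ε) := by ring
    have e4 : C * D * ε ^ (i + j) * (3 * ε) ^ (n + 1) * ‖x‖ =
        C * D * ε ^ (i + j) * (3 * ε) ^ n * ‖x‖ * (3 * ε) := by ring
    rw [e1, e2, e3, e4, ← mul_add, ← mul_add]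
    exact mul_le_mul_of_nonneg_left (by nlinarith) hk

theorem Subalgebra.circleMoment_mem {A : Type*} [NormedRing A] [NormedAlgebra ℂ A]
    [CompleteSpace A] {S : Subalgebra ℂ A} (hS : IsClosed (S : Set A)) {a : A} (haS : a ∈ S)
    (ha : (spectrum ℂ a).Countable) {R : ℝ} (hR : 0 < R)
    (hsph : Metric.sphere 0 R ⊆ resolventSet ℂ a) (m : ℤ) : circleMoment a R m ∈ S := by
  have : CompleteSpace S := hS.completeSpace_coe
  let t : S := ⟨a, haS⟩
  have htspec : spectrum ℂ t = spectrum ℂ a :=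
    Subalgebra.spectrum_eq_of_isPreconnected_compl S t
      (ha.isConnected_compl_of_one_lt_rank (by simp)).isPreconnected
  have hres : resolventSet ℂ t = resolventSet ℂ a := compl_injective htspec
  let L : S →L[ℂ] A := S.toSubmodule.subtypeL
  have h1 := map_circleMoment L hR (hres ▸ hsph) m
  have h2 : L (circleMoment t R m) = circleMoment a R m := by
    rw [h1, circleMoment]
    congr 1
    refine circleIntegral.integral_congr hR.le fun z hz => ?_
    congr 1
    have e1 : (algebraMap ℂ A z - a) * L (resolvent t z) = 1 :=
      congrArg (Subtype.val : S → A) (Ring.mul_inverse_cancel (algebraMap ℂ S z - t)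
        (hres ▸ hsph hz : z ∈ resolventSet ℂ t))
    have e2 : resolvent a z * (algebraMap ℂ A z - a) = 1 := Ring.inverse_mul_cancel _ (hsph hz)
    exact (left_inv_eq_right_inv e2 e1).symm
  rw [← h2]
  exact (circleMoment t R m).2

/-- The subalgebra of operators leaving a subspace invariant. -/
def Submodule.stabilizerSubalgebra {E : Type*} [NormedAddCommGroup E] [NormedSpace ℂ E]
    (J : Submodule ℂ E) : Subalgebra ℂ (E →L[ℂ] E) where
  carrier := {F | ∀ x ∈ J, F x ∈ J}
  mul_mem' := fun {F G} hF hG x hx => hF _ (hG x hx)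
  add_mem' := fun {F G} hF hG x hx => J.add_mem (hF x hx) (hG x hx)
  algebraMap_mem' := fun r x hx => by
    rw [Algebra.algebraMap_eq_smul_one]
    exact J.smul_mem r hx

theorem circleMoment_apply_mem {E : Type*} [NormedAddCommGroup E] [NormedSpace ℂ E]
    [CompleteSpace E] {J : Submodule ℂ E} (hJ : IsClosed (J : Set E)) {T : E →L[ℂ] E}
    (hTJ : ∀ x ∈ J, T x ∈ J) (hT : (spectrum ℂ T).Countable) {R : ℝ} (hR : 0 < R)
    (hsph : Metric.sphere 0 R ⊆ resolventSet ℂ T) (m : ℤ) {x : E} (hx : x ∈ J) :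
    circleMoment T R m x ∈ J := by
  have hclosed : IsClosed (J.stabilizerSubalgebra : Set (E →L[ℂ] E)) := by
    have : (J.stabilizerSubalgebra : Set (E →L[ℂ] E)) =
        ⋂ x ∈ J, (fun F : E →L[ℂ] E => F x) ⁻¹' J := by
      ext F
      simp only [Set.mem_iInter]
      rfl
    rw [this]
    exact isClosed_biInter fun x _ => hJ.preimage (by fun_prop)
  exact Subalgebra.circleMoment_mem hclosed (a := T) hTJ hT hR hsph m x hx

theorem countable_spectrum_mul_mul_sub {𝒜 : Type*} [NormedRing 𝒜] [NormedAlgebra ℂ 𝒜]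
    [CompleteSpace 𝒜] {a b : 𝒜} (ha : (spectrum ℂ a).Countable) (hb : (spectrum ℂ b).Countable) :
    ∃ T : 𝒜 →L[ℂ] 𝒜, (spectrum ℂ T).Countable ∧ ∀ x, T x = a * x * b - x := by
  have hLR : Commute (ContinuousLinearMap.mul ℂ 𝒜 a) ((ContinuousLinearMap.mul ℂ 𝒜).flip b) := by
    ext1 x
    exact (mul_assoc _ _ _).symm
  refine ⟨_, countable_spectrum_add_smul_one (hLR.countable_spectrum_mul
      (ha.mono (spectrum_mulLeft_subset _)) (hb.mono (spectrum_mulRight_subset _))) (-1),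
      fun x => ?_⟩
  change (-1 : ℂ) • x + a * (x * b) = _
  rw [neg_one_smul, ← mul_assoc]; abel

theorem exists_sub_circleMoment_apply_eq_iterate {E : Type*} [NormedAddCommGroup E]
    [NormedSpace ℂ E] [CompleteSpace E] {T : E →L[ℂ] E} {R : ℝ} (hR : 0 < R)
    (hT : Metric.sphere 0 R ⊆ resolventSet ℂ T) :
    ∃ C : ℝ, 0 < C ∧ ∀ (x : E) (n : ℕ), ∃ m : E,
      x - circleMoment T R 0 x = -(T^[n + 1] m) ∧ ‖m‖ ≤ C * (R ^ (n + 1))⁻¹ * ‖x‖ := by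
  obtain ⟨C, hC0, hC⟩ := circleMoment_bound hR hT
  refine ⟨C, hC0, fun x n => ⟨circleMoment T R (-(n + 1 : ℕ)) x, ?_, ?_⟩⟩
  · rw [← FunLike.coe_pow_eq_iterate]
    exact DFunLike.congr_fun (one_sub_circleMoment_zero hR hT n) x
  · refine (ContinuousLinearMap.le_opNorm _ x).trans
      (mul_le_mul_of_nonneg_right ((hC _).trans_eq ?_) (norm_nonneg _))
    rw [zpow_neg, zpow_natCast]

theorem circleMoment_zero_apply_eq_self {X : Type*} [NormedAddCommGroup X] [NormedSpace ℂ X]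
    [CompleteSpace X] {J : Submodule ℂ (X →L[ℂ] X)} (hclosed : IsClosed (J : Set (X →L[ℂ] X)))
    (hfr : ∀ F ∈ J, FiniteDimensional ℂ (LinearMap.range (F : X →ₗ[ℂ] X)) → F = 0)
    {c d : X →L[ℂ] X} (hc : IsCompactOperator c) (hd : IsCompactOperator d)
    {T : (X →L[ℂ] X) →L[ℂ] (X →L[ℂ] X)} (hTspec : (spectrum ℂ T).Countable)
    (hTapp : ∀ x, T x = c * x + x * d + c * x * d) (hTJ : ∀ x ∈ J, T x ∈ J)
    {ε κ : ℝ} (hε0 : 0 < ε) (hε1 : ε ≤ 1) (hκε : 3 * ε < κ)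
    (hκt : Metric.sphere 0 κ ⊆ resolventSet ℂ T) {x : X →L[ℂ] X} (hx : x ∈ J) :
    circleMoment T κ 0 x = x := by
  have hκ0 : 0 < κ := by linarith
  obtain ⟨P, hP, C, hC0, hC⟩ := hc.exists_finiteRank_truncation hε0
  obtain ⟨Q, hQ, D, hD0, hD⟩ := hd.exists_finiteRank_truncation hε0
  obtain ⟨E, hE0, hE⟩ := exists_sub_circleMoment_apply_eq_iterate hκ0 hκt
  obtain ⟨y, hy⟩ : ∃ y, y = x - circleMoment T κ 0 x := ⟨_, rfl⟩
  have hyJ : y ∈ J := hy ▸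
    J.sub_mem hx (circleMoment_apply_mem hclosed hTJ hTspec hκ0 hκt 0 hx)
  have hy0 : (1 - P) * y * (1 - Q) = 0 := by
    have hb : ∀ n : ℕ, ‖(1 - P) * y * (1 - Q)‖ ≤
        C * D * E * ‖x‖ * (3 * ε / κ) ^ (n + 1) := fun n => by
      obtain ⟨m, hm, hmn⟩ := hE x n
      have := norm_truncated_pow_le (p := 1 - P) (q := 1 - Q) hD0.le hC0.le hε0 hε1
        (fun n => (hC n).2) (fun n => (hD n).1) hTapp m (n + 1) 0 0
      simp only [pow_zero, mul_one, one_mul, add_zero] at this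
      rw [hy, hm, mul_neg, neg_mul, norm_neg]
      refine this.trans ?_
      calc C * D * (3 * ε) ^ (n + 1) * ‖m‖
          ≤ C * D * (3 * ε) ^ (n + 1) * (E * (κ ^ (n + 1))⁻¹ * ‖x‖) := by gcongr
        _ = _ := by rw [div_pow, div_eq_mul_inv]; ring
    have hlim : Tendsto (fun n : ℕ => C * D * E * ‖x‖ * (3 * ε / κ) ^ (n + 1)) atTop
        (𝓝 (C * D * E * ‖x‖ * 0)) :=
      ((tendsto_pow_atTop_nhds_zero_of_lt_one (by positivity)
        ((div_lt_one hκ0).2 hκε)).comp (tendsto_add_atTop_nat 1)).const_mul _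
    rw [mul_zero] at hlim
    exact norm_le_zero_iff.1 (ge_of_tendsto' hlim hb)
  have : y = 0 := hfr y hyJ (finiteDimensional_range_of_truncation hP hQ hy0)
  rw [hy] at this
  exact (sub_eq_zero.1 this).symm

theorem circleMoment_intertwine {E F : Type*} [NormedAddCommGroup E] [NormedSpace ℂ E]
    [CompleteSpace E] [NormedAddCommGroup F] [NormedSpace ℂ F] [CompleteSpace F]
    {T : E →L[ℂ] E} {h : F →L[ℂ] F} (L : E →L[ℂ] F) (hL : ∀ x, L (T x) = h (L x)) {R : ℝ}
    (hR : 0 < R) (hT : Metric.sphere 0 R ⊆ resolventSet ℂ T)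
    (hh : Metric.sphere 0 R ⊆ resolventSet ℂ h) (m : ℤ) (x : E) :
    L (circleMoment T R m x) = circleMoment h R m (L x) := by
  have h1 := map_circleMoment (L ∘L ContinuousLinearMap.apply ℂ E x) hR hT m
  have h2 := map_circleMoment (ContinuousLinearMap.apply ℂ F (L x)) hR hh m
  refine h1.trans (Eq.trans ?_ h2.symm)
  congr 1
  refine circleIntegral.integral_congr hR.le fun z hz => ?_
  congr 1
  change L (resolvent T z x) = resolvent h z (L x)
  have e1 : (algebraMap ℂ (E →L[ℂ] E) z - T) * resolvent T z = 1 :=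
    Ring.mul_inverse_cancel _ (hT hz)
  have e2 : resolvent h z * (algebraMap ℂ (F →L[ℂ] F) z - h) = 1 :=
    Ring.inverse_mul_cancel _ (hh hz)
  rw [Algebra.algebraMap_eq_smul_one] at e1 e2
  have e3 : z • resolvent T z x - T (resolvent T z x) = x := DFunLike.congr_fun e1 x
  have e4 : resolvent h z (z • L (resolvent T z x) - h (L (resolvent T z x))) =
      L (resolvent T z x) := DFunLike.congr_fun e2 _
  rw [← e4, ← hL, ← map_smul, ← map_sub, e3]

/-- If a closed space `J` of operators without finite-rank elements is stable under
`x ↦ (1 + c) x (1 + d)` with `c`, `d` compact, then `J` is finite dimensional on each eigenvector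
of `d` with nonzero eigenvalue. -/
theorem exists_finiteDimensional_orbit {X : Type*} [NormedAddCommGroup X] [NormedSpace ℂ X]
    [CompleteSpace X] {J : Submodule ℂ (X →L[ℂ] X)} (hclosed : IsClosed (J : Set (X →L[ℂ] X)))
    (hfr : ∀ F ∈ J, FiniteDimensional ℂ (LinearMap.range (F : X →ₗ[ℂ] X)) → F = 0)
    {c d : X →L[ℂ] X} (hc : IsCompactOperator c) (hd : IsCompactOperator d)
    (hJ : ∀ x ∈ J, (1 + c) * x * (1 + d) ∈ J) {v : X} {ν : ℂ} (hν : ν ≠ 0) (hv : d v = ν • v) :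
    ∃ V : Submodule ℂ X, FiniteDimensional ℂ V ∧ ∀ x ∈ J, x v ∈ V := by
  have hone : ∀ {e : X →L[ℂ] X}, IsCompactOperator e → (spectrum ℂ (1 + e)).Countable :=
    fun he => by simpa using countable_spectrum_add_smul_one he.countable_spectrum 1
  obtain ⟨T, hTspec, hT⟩ := countable_spectrum_mul_mul_sub (hone hc) (hone hd)
  have hTapp : ∀ x, T x = c * x + x * d + c * x * d := fun x => by
    rw [hT]; noncomm_ring
  have hTJ : ∀ x ∈ J, T x ∈ J := fun x hx => by
    rw [hT]
    exact J.sub_mem (hJ x hx) hx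
  obtain ⟨k, hk⟩ : ∃ k, k = (1 + ν) • c := ⟨_, rfl⟩
  have hkc : IsCompactOperator k := hk ▸ hc.smul (1 + ν)
  have hhspec : (spectrum ℂ (ν • 1 + k)).Countable :=
    countable_spectrum_add_smul_one hkc.countable_spectrum ν
  have hTv : ∀ x : X →L[ℂ] X, T x v = (ν • 1 + k : X →L[ℂ] X) (x v) := fun x => by
    rw [hTapp, hk]
    change c (x v) + x (d v) + c (x (d v)) = ν • x v + (1 + ν) • c (x v)
    rw [hv, map_smul, map_smul, add_smul, one_smul]; abel
  have hνpos : 0 < ‖ν‖ := norm_pos_iff.2 hν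
  obtain ⟨ε, hε0, hε1, hεν⟩ : ∃ ε : ℝ, 0 < ε ∧ ε ≤ 1 ∧ 3 * ε < ‖ν‖ :=
    ⟨min 1 (‖ν‖ / 4), by positivity, min_le_left _ _, by
      have := min_le_right 1 (‖ν‖ / 4); linarith⟩
  obtain ⟨κ, hκε, hκν, hκ⟩ := (hTspec.union hhspec).exists_sphere_subset_compl hεν
  have hκ0 : 0 < κ := by linarith
  have hκt : Metric.sphere 0 κ ⊆ resolventSet ℂ T := fun z hz => by
    have : z ∉ spectrum ℂ T := fun h => hκ hz (Or.inl h)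
    rwa [spectrum, Set.notMem_compl_iff] at this
  have hκh : Metric.sphere 0 κ ⊆ resolventSet ℂ (ν • 1 + k) := fun z hz => by
    have : z ∉ spectrum ℂ (ν • 1 + k) := fun h => hκ hz (Or.inr h)
    rwa [spectrum, Set.notMem_compl_iff] at this
  have hKc := hkc.circleMoment_zero hκ0 hκν hκh
  have heval : ∀ x ∈ J, circleMoment (ν • 1 + k) κ 0 (x v) = x v := by
    intro x hx
    have := circleMoment_intertwine (ContinuousLinearMap.apply ℂ X v) hTv hκ0 hκt hκh 0 x
    rw [circleMoment_zero_apply_eq_self hclosed hfr hc hd hTspec hTapp hTJ hε0 hε1 hκε hκt hx]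
      at this
    exact this.symm
  refine ⟨J.map (ContinuousLinearMap.apply ℂ X v : (X →L[ℂ] X) →ₗ[ℂ] X),
    hKc.finiteDimensional_of_fixed _ ?_, fun x hx => ⟨x, hx, rfl⟩⟩
  rintro _ ⟨x, hx, rfl⟩
  exact heval x hx

section JordanClosed

variable {𝒜 : Type*} [Ring 𝒜] [Algebra ℂ 𝒜] {J : Submodule ℂ 𝒜}

theorem mul_self_mem_of_jordan (hJ : ∀ A ∈ J, ∀ B ∈ J, A * B + B * A ∈ J) {a : 𝒜} (ha : a ∈ J) :
    a * a ∈ J := by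
  have h : a * a = (2⁻¹ : ℂ) • (a * a + a * a) := by
    rw [← two_smul ℂ (a * a), smul_smul]; norm_num
  rw [h]
  exact J.smul_mem _ (hJ a ha a ha)

theorem mul_mul_self_mem_of_jordan (hJ : ∀ A ∈ J, ∀ B ∈ J, A * B + B * A ∈ J) {a x : 𝒜}
    (ha : a ∈ J) (hx : x ∈ J) : a * x * a ∈ J := by
  have h : a * x * a = (2⁻¹ : ℂ) • (a * (a * x + x * a) + (a * x + x * a) * a -
      (a * a * x + x * (a * a))) := by
    have : a * (a * x + x * a) + (a * x + x * a) * a - (a * a * x + x * (a * a)) =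
        (2 : ℂ) • (a * x * a) := by
      rw [two_smul]; noncomm_ring
    rw [this, smul_smul]; norm_num
  rw [h]
  exact J.smul_mem _ (J.sub_mem (hJ a ha _ (hJ a ha x hx))
    (hJ _ (mul_self_mem_of_jordan hJ ha) x hx))

theorem pow_succ_mem_of_jordan (hJ : ∀ A ∈ J, ∀ B ∈ J, A * B + B * A ∈ J) {a : 𝒜} (ha : a ∈ J)
    (n : ℕ) : a ^ (n + 1) ∈ J := by
  induction n with
  | zero => simpa using ha
  | succ n ih =>
    have h : a ^ (n + 1 + 1) = (2⁻¹ : ℂ) • (a * a ^ (n + 1) + a ^ (n + 1) * a) := by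
      rw [← pow_succ, ← pow_succ', ← two_smul ℂ (a ^ (n + 1 + 1)), smul_smul]; norm_num
    rw [h]
    exact J.smul_mem _ (hJ a ha _ ih)

theorem aeval_mul_X_mem_of_jordan (hJ : ∀ A ∈ J, ∀ B ∈ J, A * B + B * A ∈ J) {a : 𝒜} (ha : a ∈ J)
    (p : Polynomial ℂ) : Polynomial.aeval a (p * Polynomial.X) ∈ J := by
  induction p using Polynomial.induction_on' with
  | add p q hp hq =>
    rw [add_mul, map_add]
    exact J.add_mem hp hq
  | monomial n c =>
    rw [Polynomial.monomial_mul_X, Polynomial.aeval_monomial, ← Algebra.smul_def]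
    exact J.smul_mem _ (pow_succ_mem_of_jordan hJ ha n)

end JordanClosed

/-- An algebraic non-nilpotent element has a nonzero idempotent polynomial multiple. -/
theorem exists_isIdempotentElem_aeval_mul_X {𝒜 : Type*} [Ring 𝒜] [Algebra ℂ 𝒜] {a : 𝒜}
    {p : Polynomial ℂ} (hp : p ≠ 0) (hpa : Polynomial.aeval a p = 0) (ha : ∀ n, a ^ (n + 1) ≠ 0) :
    ∃ q : Polynomial ℂ, IsIdempotentElem (Polynomial.aeval a (q * Polynomial.X)) ∧
      Polynomial.aeval a (q * Polynomial.X) ≠ 0 := by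
  obtain ⟨r, hr, hndvd⟩ := Polynomial.exists_eq_pow_rootMultiplicity_mul_and_not_dvd p hp 0
  rw [Polynomial.C_0, sub_zero] at hr hndvd
  obtain ⟨m, hm⟩ : ∃ m, m = p.rootMultiplicity 0 := ⟨_, rfl⟩
  rw [← hm] at hr
  obtain ⟨u, v, huv⟩ : IsCoprime (Polynomial.X ^ (m + 1)) r :=
    ((Polynomial.irreducible_X.coprime_iff_not_dvd).2 hndvd).pow_left
  have hpX : Polynomial.aeval a (Polynomial.X ^ (m + 1) * r) = 0 := by
    rw [pow_succ', mul_assoc, ← hr, map_mul, hpa, mul_zero]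
  have hq : u * Polynomial.X ^ m * Polynomial.X = u * Polynomial.X ^ (m + 1) := by ring
  refine ⟨u * Polynomial.X ^ m, ?_, fun h => ha m ?_⟩
  · rw [hq, IsIdempotentElem, ← map_mul, ← sub_eq_zero, ← map_sub]
    have : u * Polynomial.X ^ (m + 1) * (u * Polynomial.X ^ (m + 1)) - u * Polynomial.X ^ (m + 1) =
        -(u * v) * (Polynomial.X ^ (m + 1) * r) := by
      linear_combination (u * Polynomial.X ^ (m + 1)) * huv
    rw [this, map_mul, hpX, mul_zero]
  · rw [hq] at h
    have : Polynomial.X ^ (m + 1) = Polynomial.X ^ (m + 1) * (u * Polynomial.X ^ (m + 1)) +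
        v * (Polynomial.X ^ (m + 1) * r) := by
      linear_combination -(Polynomial.X ^ (m + 1)) * huv
    have h2 := congrArg (Polynomial.aeval a) this
    rwa [map_add, map_mul, h, map_mul _ v, hpX, mul_zero, mul_zero, add_zero, map_pow,
      Polynomial.aeval_X] at h2

/-- The finite-rank operators. -/
def finiteRankOperators (X : Type*) [NormedAddCommGroup X] [NormedSpace ℂ X] :
    Submodule ℂ (X →L[ℂ] X) where
  carrier := {F | FiniteDimensional ℂ (LinearMap.range (F : X →ₗ[ℂ] X))}
  zero_mem' := by
    change FiniteDimensional ℂ (LinearMap.range (0 : X →ₗ[ℂ] X))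
    rw [LinearMap.range_zero]; infer_instance
  add_mem' {F G} hF hG := by
    have : FiniteDimensional ℂ (LinearMap.range (F : X →ₗ[ℂ] X)) := hF
    have : FiniteDimensional ℂ (LinearMap.range (G : X →ₗ[ℂ] X)) := hG
    exact Submodule.finiteDimensional_of_le
      (LinearMap.range_add_le (F : X →ₗ[ℂ] X) (G : X →ₗ[ℂ] X))
  smul_mem' c F hF := by
    have : FiniteDimensional ℂ (LinearMap.range (F : X →ₗ[ℂ] X)) := hF
    refine Submodule.finiteDimensional_of_le (S₂ := LinearMap.range (F : X →ₗ[ℂ] X)) ?_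
    rintro _ ⟨x, rfl⟩
    exact ⟨c • x, map_smul F c x⟩

section FiniteRank

variable {X : Type*} [NormedAddCommGroup X] [NormedSpace ℂ X]

theorem mul_mem_finiteRankOperators_left {F : X →L[ℂ] X} (hF : F ∈ finiteRankOperators X)
    (G : X →L[ℂ] X) : F * G ∈ finiteRankOperators X := by
  have : FiniteDimensional ℂ (LinearMap.range (F : X →ₗ[ℂ] X)) := hF
  refine Submodule.finiteDimensional_of_le (S₂ := LinearMap.range (F : X →ₗ[ℂ] X)) ?_
  rintro _ ⟨x, rfl⟩
  exact ⟨G x, rfl⟩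

theorem mul_mem_finiteRankOperators_right {F : X →L[ℂ] X} (hF : F ∈ finiteRankOperators X)
    (G : X →L[ℂ] X) : G * F ∈ finiteRankOperators X := by
  have : FiniteDimensional ℂ (LinearMap.range (F : X →ₗ[ℂ] X)) := hF
  refine Submodule.finiteDimensional_of_le
    (S₂ := (LinearMap.range (F : X →ₗ[ℂ] X)).map (G : X →ₗ[ℂ] X)) ?_
  rintro _ ⟨x, rfl⟩
  exact ⟨F x, ⟨x, rfl⟩, rfl⟩

theorem exists_aeval_eq_zero_of_mem_finiteRankOperators {F : X →L[ℂ] X}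
    (hF : F ∈ finiteRankOperators X) :
    ∃ p : Polynomial ℂ, p ≠ 0 ∧ Polynomial.aeval F p = 0 := by
  have : FiniteDimensional ℂ (LinearMap.range (F : X →ₗ[ℂ] X)) := hF
  let f : LinearMap.range (F : X →ₗ[ℂ] X) →ₗ[ℂ] LinearMap.range (F : X →ₗ[ℂ] X) :=
    (F : X →ₗ[ℂ] X).restrict fun x _ => ⟨x, rfl⟩
  have hf : ∀ (p : Polynomial ℂ) (y : LinearMap.range (F : X →ₗ[ℂ] X)),
      (Polynomial.aeval F p) (y : X) = (Polynomial.aeval f p y : X) := by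
    intro p
    induction p using Polynomial.induction_on' with
    | add p q hp hq =>
      intro y
      rw [map_add, map_add]
      exact congrArg₂ (· + ·) (hp y) (hq y)
    | monomial n c =>
      induction n with
      | zero =>
        intro y
        simp [Algebra.algebraMap_eq_smul_one]
      | succ n ih =>
        intro y
        rw [← Polynomial.monomial_mul_X, map_mul, map_mul, Polynomial.aeval_X, Polynomial.aeval_X]
        exact ih (f y)
  refine ⟨f.charpoly * Polynomial.X, mul_ne_zero f.charpoly_monic.ne_zero Polynomial.X_ne_zero, ?_⟩
  ext x
  rw [map_mul, Polynomial.aeval_X]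
  change (Polynomial.aeval F f.charpoly) (F x) = 0
  rw [hf _ ⟨F x, ⟨x, rfl⟩⟩, LinearMap.aeval_self_charpoly]
  rfl

end FiniteRank

section FiniteRankCase

variable {X : Type*} [NormedAddCommGroup X] [NormedSpace ℂ X] {J : Submodule ℂ (X →L[ℂ] X)}

theorem exists_minimal_idempotent (hJ : ∀ A ∈ J, ∀ B ∈ J, A * B + B * A ∈ J)
    (hnil : ∀ F ∈ J, F ∈ finiteRankOperators X → ∀ n : ℕ, F ^ (n + 1) = 0 → F = 0)
    (hF : ∃ F ∈ J, F ∈ finiteRankOperators X ∧ F ≠ 0) :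
    ∃ P ∈ J, P ∈ finiteRankOperators X ∧ P ≠ 0 ∧ P * P = P ∧
      ∀ A ∈ J, ∃ μ : ℂ, P * A * P = μ • P := by
  have hidem : ∀ F ∈ J, F ∈ finiteRankOperators X → F ≠ 0 →
      ∃ G, F * G ∈ J ∧ F * G = G * F ∧ F * G * (F * G) = F * G ∧ F * G ≠ 0 := by
    intro F hF hfin hF0
    obtain ⟨p, hp, hpF⟩ := exists_aeval_eq_zero_of_mem_finiteRankOperators hfin
    obtain ⟨q, hq, hq0⟩ := exists_isIdempotentElem_aeval_mul_X hp hpF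
      fun n h => hF0 (hnil F hF hfin n h)
    have h1 : Polynomial.aeval F (q * Polynomial.X) = F * Polynomial.aeval F q := by
      rw [mul_comm, map_mul, Polynomial.aeval_X]
    have h2 : Polynomial.aeval F (q * Polynomial.X) = Polynomial.aeval F q * F := by
      rw [map_mul, Polynomial.aeval_X]
    have h3 := aeval_mul_X_mem_of_jordan hJ hF q
    rw [IsIdempotentElem] at hq
    refine ⟨Polynomial.aeval F q, h1 ▸ h3, h1.symm.trans h2, ?_, ?_⟩ <;> rwa [← h1]
  let r : (X →L[ℂ] X) → ℕ := fun F => Module.finrank ℂ (LinearMap.range (F : X →ₗ[ℂ] X))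
  obtain ⟨P, ⟨hPJ, hPfin, hP0, hPP⟩, hPmin⟩ : ∃ P, (P ∈ J ∧ P ∈ finiteRankOperators X ∧ P ≠ 0 ∧
      P * P = P) ∧ ∀ Q, (Q ∈ J ∧ Q ∈ finiteRankOperators X ∧ Q ≠ 0 ∧ Q * Q = Q) → r P ≤ r Q := by
    obtain ⟨F, hF, hfin, hF0⟩ := hF
    obtain ⟨G, h1, -, h2, h3⟩ := hidem F hF hfin hF0
    let S : Set (X →L[ℂ] X) := {Q | Q ∈ J ∧ Q ∈ finiteRankOperators X ∧ Q ≠ 0 ∧ Q * Q = Q}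
    have hS : S.Nonempty := ⟨F * G, h1, mul_mem_finiteRankOperators_left hfin G, h3, h2⟩
    exact ⟨Function.argminOn r S hS, Function.argminOn_mem r S hS,
      fun Q hQ => Function.argminOn_le r S hQ⟩
  refine ⟨P, hPJ, hPfin, hP0, hPP, fun A hA => ?_⟩
  have : FiniteDimensional ℂ (LinearMap.range (P : X →ₗ[ℂ] X)) := hPfin
  have hfix : ∀ w ∈ LinearMap.range (P : X →ₗ[ℂ] X), P w = w := by
    rintro _ ⟨x, rfl⟩
    exact DFunLike.congr_fun hPP x
  have : Nontrivial (LinearMap.range (P : X →ₗ[ℂ] X)) := by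
    obtain ⟨x, hx⟩ : ∃ x, P x ≠ 0 := by
      by_contra! h
      exact hP0 (ContinuousLinearMap.ext h)
    exact ⟨⟨⟨P x, x, rfl⟩, 0, fun h => hx (congrArg Subtype.val h)⟩⟩
  let f : LinearMap.range (P : X →ₗ[ℂ] X) →ₗ[ℂ] LinearMap.range (P : X →ₗ[ℂ] X) :=
    ((P * A * P : X →L[ℂ] X) : X →ₗ[ℂ] X).restrict fun x _ => ⟨A (P x), rfl⟩
  obtain ⟨μ, hμ⟩ := Module.End.exists_eigenvalue f
  obtain ⟨w, hw⟩ := hμ.exists_hasEigenvector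
  have hw1 : (P * A * P) (w : X) = μ • (w : X) := congrArg Subtype.val hw.apply_eq_smul
  have hw0 : (w : X) ≠ 0 := fun h => hw.2 (Subtype.ext h)
  refine ⟨μ, ?_⟩
  by_contra hne
  obtain ⟨C, hC⟩ : ∃ C, C = P * A * P - μ • P := ⟨_, rfl⟩
  have hCw : C w = 0 := by
    rw [hC]
    change (P * A * P) (w : X) - μ • P w = 0
    rw [hw1, hfix _ w.2, sub_self]
  have hPC : P * C = C := by
    rw [hC, mul_sub, mul_smul_comm, hPP, ← mul_assoc, ← mul_assoc, hPP]
  have hCJ : C ∈ J := hC ▸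
    J.sub_mem (mul_mul_self_mem_of_jordan hJ hPJ hA) (J.smul_mem μ hPJ)
  have hCfin : C ∈ finiteRankOperators X := hPC ▸ mul_mem_finiteRankOperators_left hPfin C
  obtain ⟨G, h1, h2, h3, h4⟩ := hidem C hCJ hCfin (hC ▸ sub_ne_zero.2 hne)
  have hle := hPmin (C * G) ⟨h1, mul_mem_finiteRankOperators_left hCfin G, h4, h3⟩
  have hsub : LinearMap.range ((C * G : X →L[ℂ] X) : X →ₗ[ℂ] X) ≤
      LinearMap.range (P : X →ₗ[ℂ] X) := by
    rintro _ ⟨x, rfl⟩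
    rw [← hPC]
    exact ⟨C (G x), rfl⟩
  have heq := Submodule.eq_of_le_of_finrank_le hsub hle
  obtain ⟨x, hx⟩ : (w : X) ∈ LinearMap.range ((C * G : X →L[ℂ] X) : X →ₗ[ℂ] X) := by
    rw [heq]; exact w.2
  have hx' : (C * G) x = w := hx
  refine hw0 ?_
  rw [← hx', ← h3, h2]
  change G (C ((G * C) x)) = 0
  rw [← h2, hx', hCw, map_zero]

theorem peirce_nilpotent {𝒜 : Type*} [Ring 𝒜] [Algebra ℂ 𝒜] {P B : 𝒜} (hP : P * P = P)
    (hB : P * B + B * P = B) (hPB : P * (B * B) * P = P) :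
    ((2 : ℂ) • P - B * B + Complex.I • B) * ((2 : ℂ) • P - B * B + Complex.I • B) = 0 ∧
      P * ((2 : ℂ) • P - B * B + Complex.I • B) * P = P := by
  obtain ⟨b, hb⟩ : ∃ b, b = P * B := ⟨_, rfl⟩
  obtain ⟨c, hc⟩ : ∃ c, c = B * P := ⟨_, rfl⟩
  have hpbp : P * B * P = 0 := by
    have := congrArg (P * ·) hB
    simp only [mul_add, ← mul_assoc, hP] at this
    exact add_eq_left.1 this
  have hBbc : B = b + c := by rw [hb, hc, hB]
  have pb : P * b = b := by rw [hb, ← mul_assoc, hP]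
  have bp : b * P = 0 := by rw [hb, hpbp]
  have cp : c * P = c := by rw [hc, mul_assoc, hP]
  have pc : P * c = 0 := by rw [hc, ← mul_assoc, hpbp]
  have bb : b * b = 0 := by nth_rewrite 2 [hb]; rw [← mul_assoc, bp, zero_mul]
  have cc : c * c = 0 := by nth_rewrite 1 [hc]; rw [mul_assoc, pc, mul_zero]
  have bc : b * c = P := by rw [hb, hc, mul_assoc, ← mul_assoc B, ← mul_assoc, hPB]
  have hBB : B * B = P + c * b := by
    rw [hBbc, add_mul, mul_add, mul_add, bb, cc, bc, zero_add, add_zero]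
  have hD : (2 : ℂ) • P - B * B = P - c * b := by rw [hBB, two_smul]; abel
  have cbcb : c * b * (c * b) = c * b := by rw [mul_assoc, ← mul_assoc b, bc, pb]
  have h1 : (P - c * b) * (P - c * b) = P + c * b := by
    rw [sub_mul, mul_sub, mul_sub, hP, cbcb, ← mul_assoc P, pc, mul_assoc c b P, bp]; simp
  have h2 : (P - c * b) * B + B * (P - c * b) = 0 := by
    have e1 : c * b * b = 0 := by rw [mul_assoc, bb, mul_zero]
    have e2 : c * b * c = c := by rw [mul_assoc, bc, cp]
    have e3 : b * (c * b) = b := by rw [← mul_assoc, bc, pb]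
    have e4 : c * (c * b) = 0 := by rw [← mul_assoc, cc, zero_mul]
    rw [hBbc, sub_mul, mul_sub, mul_add, add_mul, mul_add, add_mul, pb, pc, e1, e2, bp, cp, e3, e4]
    abel
  rw [hD]
  constructor
  · have : (P - c * b + Complex.I • B) * (P - c * b + Complex.I • B) =
        (P - c * b) * (P - c * b) + (Complex.I * Complex.I) • (B * B) +
          Complex.I • ((P - c * b) * B + B * (P - c * b)) := by
      rw [add_mul, mul_add, mul_add, smul_mul_smul_comm, mul_smul_comm, smul_mul_assoc, smul_add]
      abel
    rw [this, h1, h2, hBB, Complex.I_mul_I, smul_zero, neg_one_smul]; abel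
  · rw [mul_add, mul_sub, hP, ← mul_assoc P c, pc, zero_mul, sub_zero, add_mul, hP, mul_smul_comm,
      smul_mul_assoc, hpbp, smul_zero, add_zero]

theorem exists_invariant_of_finiteRank (hdim : 2 ≤ Module.rank ℂ X)
    (hJ : ∀ A ∈ J, ∀ B ∈ J, A * B + B * A ∈ J)
    (hnil : ∀ F ∈ J, F ∈ finiteRankOperators X → ∀ n : ℕ, F ^ (n + 1) = 0 → F = 0)
    (hF : ∃ F ∈ J, F ∈ finiteRankOperators X ∧ F ≠ 0) :
    ∃ M : Submodule ℂ X, IsClosed (M : Set X) ∧ M ≠ ⊥ ∧ M ≠ ⊤ ∧ ∀ A ∈ J, ∀ x ∈ M, A x ∈ M := by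
  obtain ⟨P, hPJ, hPfin, hP0, hPP, hscal⟩ := exists_minimal_idempotent hJ hnil hF
  have hpe : ∀ A ∈ J, A * P = P * A * P := by
    intro A hA
    obtain ⟨B, hB⟩ : ∃ B, B = P * A + A * P - (2 : ℂ) • (P * A * P) := ⟨_, rfl⟩
    have hBJ : B ∈ J := hB ▸ J.sub_mem (hJ P hPJ A hA)
      (J.smul_mem _ (mul_mul_self_mem_of_jordan hJ hPJ hA))
    have hBfin : B ∈ finiteRankOperators X := hB ▸ Submodule.sub_mem _
      (Submodule.add_mem _ (mul_mem_finiteRankOperators_left hPfin A)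
        (mul_mem_finiteRankOperators_right hPfin A))
      (Submodule.smul_mem _ _ (mul_mem_finiteRankOperators_right hPfin _))
    have hPB : P * B = P * A - P * A * P := by
      rw [hB, mul_sub, mul_add, mul_smul_comm, ← mul_assoc, ← mul_assoc, ← mul_assoc, ← mul_assoc,
        hPP, two_smul]; abel
    have hBP : B * P = A * P - P * A * P := by
      rw [hB, sub_mul, add_mul, smul_mul_assoc, mul_assoc A, mul_assoc (P * A) P P, hPP, two_smul]
      abel
    have hBB : P * B + B * P = B := by rw [hPB, hBP, hB, two_smul]; abel
    have hPBP : P * B * P = 0 := by rw [hPB, sub_mul, mul_assoc (P * A) P P, hPP, sub_self]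
    have hB0 : B = 0 := by
      by_contra hne
      obtain ⟨μ, hμ⟩ := hscal _ (mul_self_mem_of_jordan hJ hBJ)
      rcases eq_or_ne μ 0 with rfl | hμ0
      · refine hne (hnil B hBJ hBfin 2 ?_)
        rw [zero_smul] at hμ
        have e1 : P * (B * B) = 0 := by
          have : P * B * B = P * B * (P * B + B * P) := by rw [hBB]
          rw [mul_add, ← mul_assoc, hPBP, zero_mul, zero_add] at this
          rw [← mul_assoc, this, ← hμ]; noncomm_ring
        have e2 : B * B * P = 0 := by
          have : B * (B * P) = (P * B + B * P) * (B * P) := by rw [hBB]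
          rw [add_mul] at this
          have e3 : B * P * (B * P) = 0 := by
            rw [mul_assoc, ← mul_assoc P, hPBP, mul_zero]
          have e4 : P * B * (B * P) = 0 := by rw [← hμ]; noncomm_ring
          rw [mul_assoc, this, e3, e4, add_zero]
        calc B ^ (2 + 1) = B * B * (P * B + B * P) := by rw [hBB]; noncomm_ring
          _ = B * B * P * B + B * (B * B * P) := by noncomm_ring
          _ = 0 := by rw [e2, zero_mul, mul_zero, add_zero]
      · obtain ⟨s, hs⟩ := IsAlgClosed.exists_pow_nat_eq μ two_pos
        have hs0 : s ≠ 0 := by rintro rfl; exact hμ0 (by rw [← hs]; simp)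
        have hB' : P * (s⁻¹ • B) + (s⁻¹ • B) * P = s⁻¹ • B := by
          rw [mul_smul_comm, smul_mul_assoc, ← smul_add, hBB]
        have hPB' : P * (s⁻¹ • B * s⁻¹ • B) * P = P := by
          rw [smul_mul_smul_comm, mul_smul_comm, smul_mul_assoc, hμ, smul_smul, ← hs]
          rw [show s⁻¹ * s⁻¹ * s ^ 2 = 1 by field_simp, one_smul]
        obtain ⟨h1, h2⟩ := peirce_nilpotent hPP hB' hPB'
        have hsB : s⁻¹ • B ∈ J := J.smul_mem _ hBJ
        have hsBfin : s⁻¹ • B ∈ finiteRankOperators X := Submodule.smul_mem _ _ hBfin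
        have h3 := hnil _ (J.add_mem (J.sub_mem (J.smul_mem 2 hPJ) (mul_self_mem_of_jordan hJ hsB))
          (J.smul_mem Complex.I hsB)) (Submodule.add_mem _ (Submodule.sub_mem _
          (Submodule.smul_mem _ 2 hPfin) (mul_mem_finiteRankOperators_left hsBfin _))
          (Submodule.smul_mem _ Complex.I hsBfin)) 1 ((pow_two _).trans h1)
        rw [h3, mul_zero, zero_mul] at h2
        exact hP0 h2.symm
    have : B * P = 0 := by rw [hB0, zero_mul]
    rw [hBP] at this
    exact sub_eq_zero.1 this
  by_cases hP1 : P = 1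
  · subst hP1
    have : Nontrivial X := by
      by_contra h
      rw [not_nontrivial_iff_subsingleton] at h
      exact hP0 (Subsingleton.elim _ _)
    obtain ⟨x, hx⟩ := exists_ne (0 : X)
    refine ⟨Submodule.span ℂ {x}, Submodule.closed_of_finiteDimensional _, by simpa using hx,
      fun h => ?_, fun A hA y hy => ?_⟩
    · have h1 := rank_span_le (R := ℂ) ({x} : Set X)
      rw [h, rank_top, Cardinal.mk_singleton] at h1
      exact absurd (hdim.trans h1) (by norm_num)
    · obtain ⟨μ, hμ⟩ := hscal A hA
      rw [one_mul, mul_one] at hμ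
      rw [hμ]
      exact Submodule.smul_mem _ μ hy
  · have : FiniteDimensional ℂ (LinearMap.range (P : X →ₗ[ℂ] X)) := hPfin
    refine ⟨LinearMap.range (P : X →ₗ[ℂ] X), Submodule.closed_of_finiteDimensional _, fun h => ?_,
      fun h => ?_, ?_⟩
    · exact hP0 (ContinuousLinearMap.coe_injective (LinearMap.range_eq_bot.1 h))
    · refine hP1 (ContinuousLinearMap.ext fun x => ?_)
      obtain ⟨y, rfl⟩ : x ∈ LinearMap.range (P : X →ₗ[ℂ] X) := h ▸ Submodule.mem_top
      exact DFunLike.congr_fun hPP y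
    · rintro A hA _ ⟨x, rfl⟩
      exact ⟨A (P x), (DFunLike.congr_fun (hpe A hA) x).symm⟩

end FiniteRankCase

section FiniteOrbit

variable {X : Type*} [NormedAddCommGroup X] [NormedSpace ℂ X]

/-- The span of the vectors obtained by applying to `v` fewer than `n` elements of `J`. -/
def shortWordSpan (J : Submodule ℂ (X →L[ℂ] X)) (v : X) (n : ℕ) : Submodule ℂ X :=
  Submodule.span ℂ {w | ∃ L : List (X →L[ℂ] X), L.length < n ∧ (∀ a ∈ L, a ∈ J) ∧ L.prod v = w}

variable {J : Submodule ℂ (X →L[ℂ] X)} {v : X}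

theorem prod_apply_mem_shortWordSpan {n : ℕ} {L : List (X →L[ℂ] X)} (hL : L.length < n)
    (hLJ : ∀ a ∈ L, a ∈ J) : L.prod v ∈ shortWordSpan J v n :=
  Submodule.subset_span ⟨L, hL, hLJ, rfl⟩

theorem apply_mem_shortWordSpan {n : ℕ} {a : X →L[ℂ] X} (ha : a ∈ J) {w : X}
    (hw : w ∈ shortWordSpan J v n) : a w ∈ shortWordSpan J v (n + 1) := by
  induction hw using Submodule.span_induction with
  | mem w hw =>
    obtain ⟨L, hL, hLJ, rfl⟩ := hw
    refine Submodule.subset_span ⟨a :: L, by simpa using hL, by simpa using ⟨ha, hLJ⟩, ?_⟩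
    rw [List.prod_cons]; rfl
  | zero => rw [map_zero]; exact zero_mem _
  | add x y _ _ hx hy => rw [map_add]; exact add_mem hx hy
  | smul c x _ hx => rw [map_smul]; exact Submodule.smul_mem _ c hx

/-- Permuting the letters of a word only changes a sign, up to shorter words. -/
theorem List.Perm.exists_sub_smul_mem_shortWordSpan
    (hJ : ∀ A ∈ J, ∀ B ∈ J, A * B + B * A ∈ J) {L L' : List (X →L[ℂ] X)} (h : L.Perm L')
    (hL : ∀ a ∈ L, a ∈ J) :
    ∃ ε : ℂ, L.prod v - ε • L'.prod v ∈ shortWordSpan J v L.length := by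
  induction h with
  | nil => exact ⟨1, by simp⟩
  | @cons a L L' h ih =>
    obtain ⟨ε, hε⟩ := ih fun b hb => hL b (by simp [hb])
    refine ⟨ε, ?_⟩
    have := apply_mem_shortWordSpan (hL a (by simp)) hε
    rwa [map_sub, map_smul] at this
  | swap a b L =>
    refine ⟨-1, ?_⟩
    have h1 : ∀ c ∈ (b * a + a * b) :: L, c ∈ J := by
      intro c hc
      rcases List.mem_cons.1 hc with rfl | hc
      · exact hJ b (hL b (by simp)) a (hL a (by simp))
      · exact hL c (by simp [hc])
    have h2 := prod_apply_mem_shortWordSpan (v := v) (n := L.length + 1 + 1) (by simp) h1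
    rw [List.prod_cons] at h2
    rw [neg_one_smul, sub_neg_eq_add]
    have h3 : ((b * a + a * b) * L.prod) v = (b :: a :: L).prod v + (a :: b :: L).prod v := by
      simp only [List.prod_cons]
      rfl
    exact h3 ▸ h2
  | @trans L₁ L₂ L₃ h₁ h₂ ih₁ ih₂ =>
    obtain ⟨ε, hε⟩ := ih₁ hL
    obtain ⟨δ, hδ⟩ := ih₂ fun a ha => hL a (h₁.mem_iff.2 ha)
    refine ⟨ε * δ, ?_⟩
    rw [← h₁.length_eq] at hδ
    have := add_mem hε (Submodule.smul_mem _ ε hδ)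
    rwa [smul_sub, smul_smul, sub_add_sub_cancel] at this

theorem exists_finiteDimensional_invariant (hJ : ∀ A ∈ J, ∀ B ∈ J, A * B + B * A ∈ J)
    (hV : ∃ V : Submodule ℂ X, FiniteDimensional ℂ V ∧ ∀ x ∈ J, x v ∈ V) :
    ∃ U : Submodule ℂ X, FiniteDimensional ℂ U ∧ v ∈ U ∧ ∀ a ∈ J, ∀ x ∈ U, a x ∈ U := by
  obtain ⟨s, hsJ, hs⟩ : ∃ s : Finset (X →L[ℂ] X), (∀ a ∈ s, a ∈ J) ∧
      ∀ x ∈ J, ∃ y ∈ Submodule.span ℂ (s : Set (X →L[ℂ] X)), x v = y v := by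
    obtain ⟨V, hV, hJV⟩ := hV
    let f : (X →L[ℂ] X) →ₗ[ℂ] X := (ContinuousLinearMap.apply ℂ X v : (X →L[ℂ] X) →L[ℂ] X)
    have : FiniteDimensional ℂ (J.map f) := Submodule.finiteDimensional_of_le (S₂ := V) <| by
      rintro _ ⟨x, hx, rfl⟩
      exact hJV x hx
    obtain ⟨t, ht⟩ : (J.map f).FG := Submodule.fg_iff_finiteDimensional _ |>.2 this
    classical
    have hsub : (t : Set X) ⊆ f '' J := fun y hy => by
      have : y ∈ J.map f := ht ▸ Submodule.subset_span hy
      exact this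
    obtain ⟨s, hsJ, rfl⟩ := Finset.subset_set_image_iff.1 hsub
    refine ⟨s, hsJ, fun x hx => ?_⟩
    have : f x ∈ J.map f := ⟨x, hx, rfl⟩
    rw [← ht, Finset.coe_image, Submodule.span_image] at this
    obtain ⟨y, hy, hyx⟩ := this
    exact ⟨y, hy, hyx.symm⟩
  let S : Set (List (X →L[ℂ] X)) := {L | L.length ≤ s.card ∧ ∀ a ∈ L, a ∈ s}
  have hSfin : S.Finite := by
    refine ((List.finite_length_le s s.card).image (List.map Subtype.val)).subset ?_
    rintro L ⟨hL, hLs⟩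
    lift L to List s using hLs
    exact ⟨L, by simpa using hL, rfl⟩
  let U : Submodule ℂ X := Submodule.span ℂ ((fun L => L.prod v) '' S)
  have hred : ∀ L₁ L₂ : List (X →L[ℂ] X), (∀ a ∈ L₁, a ∈ J) → (∀ a ∈ L₂, a ∈ s) →
      (L₁ ++ L₂).prod v ∈ U ⊔ shortWordSpan J v (L₁ ++ L₂).length := by
    intro L₁
    induction L₁ with
    | nil =>
      intro L _ hL
      rw [List.nil_append]
      by_cases hnd : L.Nodup
      · refine Submodule.mem_sup_left (Submodule.subset_span ⟨L, ⟨?_, hL⟩, rfl⟩)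
        classical
        rw [← List.toFinset_card_of_nodup hnd]
        exact Finset.card_le_card fun a ha => hL a (List.mem_toFinset.1 ha)
      · refine Submodule.mem_sup_right ?_
        obtain ⟨a, ha⟩ : ∃ a, [a, a].Sublist L := by
          rw [List.nodup_iff_sublist] at hnd
          push Not at hnd
          exact hnd
        obtain ⟨L', hL'⟩ := ha.exists_perm_append
        have hLJ : ∀ a ∈ L, a ∈ J := fun a ha => hsJ a (hL a ha)
        obtain ⟨ε, hε⟩ := hL'.exists_sub_smul_mem_shortWordSpan (v := v) hJ hLJ
        have h1 : ∀ b ∈ a * a :: L', b ∈ J := by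
          intro b hb
          rcases List.mem_cons.1 hb with rfl | hb
          · exact mul_self_mem_of_jordan hJ (hLJ a (hL'.mem_iff.2 (by simp)))
          · exact hLJ b (hL'.mem_iff.2 (by simp [hb]))
        have h2 := prod_apply_mem_shortWordSpan (v := v) (n := L.length)
          (by rw [hL'.length_eq]; simp) h1
        have h3 : (a * a :: L').prod = ([a, a] ++ L').prod := by simp [mul_assoc]
        rw [h3] at h2
        simpa using add_mem hε (Submodule.smul_mem _ ε h2)
    | cons x L₁ ih =>
      intro L₂ hL₁ hL₂
      have hL₁' : ∀ a ∈ L₁, a ∈ J := fun a ha => hL₁ a (by simp [ha])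
      have hLL : ∀ a ∈ L₁ ++ L₂, a ∈ J := fun a ha =>
        (List.mem_append.1 ha).elim (hL₁' a) fun h => hsJ a (hL₂ a h)
      have hlen : ∀ y, (y :: L₁ ++ L₂).length = (L₁ ++ L₂).length + 1 := fun y => rfl
      rw [hlen]
      have hxJ : x ∈ J := hL₁ x (by simp)
      obtain ⟨y, hy, hyx⟩ := hs x hxJ
      have hyJ : y ∈ J := Submodule.span_le.2 hsJ hy
      have hy' : y ((L₁ ++ L₂).prod v) ∈ U ⊔ shortWordSpan J v ((L₁ ++ L₂).length + 1) := by
        clear hyx hyJ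
        induction hy using Submodule.span_induction with
        | mem y hy =>
          obtain ⟨ε, hε⟩ := (List.perm_middle (a := y) (l₁ := L₁) (l₂ := L₂)).symm
            |>.exists_sub_smul_mem_shortWordSpan (v := v) hJ (by simpa using ⟨hsJ y hy, fun a ha =>
              hLL a (List.mem_append.2 ha)⟩)
          have h1 := ih (y :: L₂) hL₁' (by simpa using ⟨hy, hL₂⟩)
          rw [List.perm_middle.length_eq] at h1
          have h2 := add_mem (Submodule.mem_sup_right (S := U) hε) (Submodule.smul_mem _ ε h1)
          rw [sub_add_cancel, List.prod_cons] at h2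
          exact h2
        | zero => exact zero_mem _
        | add a b _ _ ha hb => exact add_mem ha hb
        | smul c a _ ha => exact Submodule.smul_mem _ c ha
      have hz : (x - y) ((L₁ ++ L₂).prod v) ∈ shortWordSpan J v ((L₁ ++ L₂).length + 1) := by
        have hzJ : x - y ∈ J := J.sub_mem hxJ hyJ
        obtain ⟨ε, hε⟩ := (List.perm_append_singleton (x - y) (L₁ ++ L₂)).symm
          |>.exists_sub_smul_mem_shortWordSpan (v := v) hJ (by simpa using ⟨hzJ, fun a ha =>
              hLL a (List.mem_append.2 ha)⟩)
        have h0 : (L₁ ++ L₂ ++ [x - y]).prod v = 0 := by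
          rw [List.prod_append, List.prod_singleton]
          change (L₁ ++ L₂).prod (x v - y v) = 0
          rw [hyx, sub_self, map_zero]
        rw [h0, smul_zero, sub_zero, List.prod_cons] at hε
        exact hε
      have := add_mem (Submodule.mem_sup_right (S := U) hz) hy'
      rw [List.cons_append, List.prod_cons]
      convert this using 1
      exact (sub_add_cancel (x _) (y _)).symm
  have hWU : ∀ n, shortWordSpan J v n ≤ U := by
    intro n
    induction n with
    | zero => exact Submodule.span_le.2 fun w ⟨L, hL, _⟩ => absurd hL (Nat.not_lt_zero _)
    | succ n ih =>
      refine Submodule.span_le.2 ?_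
      rintro _ ⟨L, hL, hLJ, rfl⟩
      have h1 := hred L [] hLJ (by simp)
      rw [List.append_nil] at h1
      refine sup_le le_rfl (le_trans (Submodule.span_mono ?_) ih) h1
      rintro _ ⟨L', hL', h⟩
      exact ⟨L', by omega, h⟩
  have hUW : U ≤ shortWordSpan J v (s.card + 1) := by
    refine Submodule.span_le.2 ?_
    rintro _ ⟨L, ⟨hL, hLs⟩, rfl⟩
    exact prod_apply_mem_shortWordSpan (by omega) fun a ha => hsJ a (hLs a ha)
  refine ⟨U, FiniteDimensional.span_of_finite ℂ (hSfin.image _), ?_, fun a ha x hx => ?_⟩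
  · exact Submodule.subset_span ⟨[], ⟨by simp, by simp⟩, rfl⟩
  · exact hWU _ (apply_mem_shortWordSpan ha (hUW hx))

end FiniteOrbit

section CompactMultiplication

variable {X : Type*} [NormedAddCommGroup X] [NormedSpace ℂ X]

/-- Two-sided multiplication by a compact operator is compact. -/
theorem IsCompactOperator.totallyBounded_mul_mul {K : X →L[ℂ] X} (hK : IsCompactOperator K)
    (R : ℝ) : TotallyBounded ((fun x => K * x * K) '' Metric.closedBall (0 : X →L[ℂ] X) R) := by
  rcases lt_or_ge R 0 with hR | hR
  · rw [Metric.closedBall_eq_empty.2 hR, Set.image_empty]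
    exact totallyBounded_empty
  rw [Metric.totallyBounded_iff]
  intro ε hε
  have hpos : 0 < 2 * (‖K‖ * R) + 2 := by positivity
  obtain ⟨η, hη0, hη⟩ : ∃ η : ℝ, 0 < η ∧ (2 * (‖K‖ * R) + 2) * η < ε :=
    ⟨ε / 2 / (2 * (‖K‖ * R) + 2), by positivity, by rw [mul_div_cancel₀ _ hpos.ne']; linarith⟩
  have hball : ∀ r : ℝ, IsCompact (closure (K '' Metric.closedBall 0 r)) := fun r =>
    hK.isCompact_closure_image_closedBall r
  obtain ⟨t, -, htf, ht⟩ := Metric.finite_approx_of_totallyBounded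
    (hball 1).totallyBounded η hη0
  have : Fintype t := htf.fintype
  let Φ : (X →L[ℂ] X) → t → X := fun x i => K (x i)
  have hΦ : TotallyBounded (Φ '' Metric.closedBall 0 R) := by
    refine (isCompact_univ_pi fun i : t => hball (R * ‖(i : X)‖)).totallyBounded.subset ?_
    rintro _ ⟨x, hx, rfl⟩ i -
    refine subset_closure ⟨x i, ?_, rfl⟩
    rw [mem_closedBall_zero_iff] at hx ⊢
    exact (x.le_opNorm _).trans (by gcongr)
  obtain ⟨F, hFs, hF, hcov⟩ := Metric.finite_approx_of_totallyBounded hΦ η hη0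
  obtain ⟨G, hG, hGf, rfl⟩ := Set.exists_subset_image_finite_and.1 ⟨F, hFs, hF, rfl⟩
  refine ⟨(fun x => K * x * K) '' G, hGf.image _, ?_⟩
  rintro _ ⟨x, hx, rfl⟩
  obtain ⟨_, ⟨y, hyG, rfl⟩, hxy⟩ := Set.mem_iUnion₂.1 (hcov ⟨x, hx, rfl⟩)
  refine Set.mem_iUnion₂.2 ⟨_, ⟨y, hyG, rfl⟩, ?_⟩
  have hy := hG hyG
  rw [mem_closedBall_zero_iff] at hx hy
  rw [Metric.mem_ball, dist_eq_norm]
  refine lt_of_le_of_lt (ContinuousLinearMap.opNorm_le_of_unit_norm (by positivity)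
    fun w hw => ?_) hη
  obtain ⟨s, hst, hs⟩ := Set.mem_iUnion₂.1 (ht (subset_closure ⟨w, by simp [hw], rfl⟩))
  rw [Metric.mem_ball, dist_eq_norm] at hs
  rw [Metric.mem_ball, dist_pi_lt_iff hη0] at hxy
  have h1 : ‖K (x s) - K (y s)‖ ≤ η := by
    rw [← dist_eq_norm]
    exact (hxy ⟨s, hst⟩).le
  have h2 : ∀ u : X →L[ℂ] X, ‖u‖ ≤ R → ‖K (u (K w - s))‖ ≤ ‖K‖ * R * η := fun u hu =>
    (K.le_opNorm _).trans <| by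
      rw [mul_assoc]
      gcongr
      exact (u.le_opNorm _).trans (by gcongr)
  have h3 : (K * x * K - K * y * K) w =
      K (x (K w - s)) - K (y (K w - s)) + (K (x s) - K (y s)) := by
    change K (x (K w)) - K (y (K w)) = _
    simp only [map_sub]; abel
  rw [h3]
  refine (norm_add_le _ _).trans ((add_le_add_left (norm_sub_le _ _) _).trans ?_)
  linarith [h2 x hx, h2 y hy]

end CompactMultiplication

section CompactSemigroup

open scoped Pointwise

variable {𝒜 : Type*} [NormedRing 𝒜]

/-- The products `k b k` with `b` in `S` of norm at most `r`. -/
def sandwichSet (S : Set 𝒜) (k : 𝒜) (r : ℝ) : Set 𝒜 := {x | ∃ b ∈ S, ‖b‖ ≤ r ∧ k * b * k = x}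

variable {S : Set 𝒜} {k : 𝒜}

theorem smul_mem_sandwichSet_pow [NormedAlgebra ℂ 𝒜] (hsmul : ∀ c : ℂ, ∀ b ∈ S, c • b ∈ S)
    {c r : ℝ} (hc : 0 ≤ c) {n : ℕ} {s : 𝒜} (hs : s ∈ sandwichSet S k r ^ n) :
    ((c : ℂ) ^ n) • s ∈ sandwichSet S k (c * r) ^ n := by
  induction n generalizing s with
  | zero => simpa using hs
  | succ n ih =>
    rw [pow_succ] at hs ⊢
    obtain ⟨u, hu, _, ⟨b, hb, hbr, rfl⟩, rfl⟩ := Set.mem_mul.1 hs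
    refine Set.mem_mul.2 ⟨_, ih hu, _, ⟨(c : ℂ) • b, hsmul _ b hb, ?_, rfl⟩, ?_⟩
    · rw [norm_smul, Complex.norm_real, Real.norm_of_nonneg hc]
      gcongr
    · simp only [mul_smul_comm, smul_mul_assoc, smul_smul, pow_succ']

theorem norm_le_of_mem_sandwichSet_pow [NormOneClass 𝒜] {r : ℝ} (hr : 0 ≤ r) {n : ℕ} {s : 𝒜}
    (hs : s ∈ sandwichSet S k r ^ n) : ‖s‖ ≤ (‖k‖ * r * ‖k‖) ^ n := by
  induction n generalizing s with
  | zero =>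
    rw [pow_zero, Set.mem_one] at hs
    simp [hs]
  | succ n ih =>
    rw [pow_succ] at hs ⊢
    obtain ⟨u, hu, _, ⟨b, hb, hbr, rfl⟩, rfl⟩ := Set.mem_mul.1 hs
    refine (norm_mul_le _ _).trans (mul_le_mul (ih hu) ?_ (norm_nonneg _) (by positivity))
    exact (norm_mul₃_le).trans (by gcongr)

theorem sandwichSet_pow_succ_subset (hmul : ∀ a ∈ S, ∀ b ∈ S, a * b ∈ S) (hk : k ∈ S) {r : ℝ}
    (n : ℕ) : sandwichSet S k r ^ (n + 1) ⊆ S := by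
  have h1 : sandwichSet S k r ⊆ S := by
    rintro _ ⟨b, hb, -, rfl⟩
    exact hmul _ (hmul _ hk _ hb) _ hk
  induction n with
  | zero => simpa using h1
  | succ n ih =>
    rw [pow_succ]
    rintro _ ⟨u, hu, v, hv, rfl⟩
    exact hmul _ (ih hu) _ (h1 hv)

theorem exists_initial_of_mem_pow {M : Set 𝒜} {n : ℕ} {s : 𝒜} (hs : s ∈ M ^ n) :
    ∃ p : ℕ → 𝒜, p 0 = 1 ∧ p n = s ∧ ∀ i j, i ≤ j → j ≤ n → ∃ q ∈ M ^ (j - i), p i * q = p j := by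
  induction n generalizing s with
  | zero =>
    rw [pow_zero, Set.mem_one] at hs
    refine ⟨fun _ => 1, rfl, hs.symm, fun i j _ _ => ⟨1, ?_, mul_one _⟩⟩
    rw [show j - i = 0 by omega]
    simp
  | succ n ih =>
    rw [pow_succ] at hs
    obtain ⟨u, hu, v, hv, rfl⟩ := Set.mem_mul.1 hs
    obtain ⟨p, hp0, hpn, hp⟩ := ih hu
    refine ⟨fun i => if i ≤ n then p i else u * v, by simp [hp0], by simp, fun i j hij hj => ?_⟩
    rcases Nat.lt_or_ge n j with h | h
    · obtain rfl : j = n + 1 := by omega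
      rcases Nat.lt_or_ge n i with h' | h'
      · refine ⟨1, ?_, by simp [h'.not_ge]⟩
        rw [show n + 1 - i = 0 by omega]
        simp
      · obtain ⟨q, hq, hpq⟩ := hp i n h' le_rfl
        refine ⟨q * v, ?_, ?_⟩
        · rw [show n + 1 - i = n - i + 1 by omega, pow_succ]
          exact Set.mul_mem_mul hq hv
        · simp only [h', if_true, h.not_ge, if_false]
          rw [← mul_assoc, hpq, hpn]
    · obtain ⟨q, hq, hpq⟩ := hp i j hij h
      exact ⟨q, hq, by simp only [hij.trans h, h, if_true, hpq]⟩

theorem exists_eq_of_mem_sandwichSet_pow {r : ℝ} {n : ℕ} {s : 𝒜}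
    (hs : s ∈ sandwichSet S k r ^ (n + 2)) :
    ∃ b u b', u ∈ sandwichSet S k r ^ n ∧ ‖b‖ ≤ r ∧ ‖b'‖ ≤ r ∧
      s = k * b * (k * u * k) * b' * k := by
  rw [pow_succ, pow_succ'] at hs
  obtain ⟨_, ⟨_, ⟨b, hb, hbr, rfl⟩, u, hu, rfl⟩, _, ⟨b', hb', hbr', rfl⟩, rfl⟩ := hs
  exact ⟨b, u, b', hu, hbr, hbr', by simp only [mul_assoc]⟩

theorem exists_isIdempotentElem_of_bounded_words [CompleteSpace 𝒜] (hS : IsClosed S)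
    (hmul : ∀ a ∈ S, ∀ b ∈ S, a * b ∈ S) (hk : k ∈ S)
    (htb : ∀ R : ℝ, TotallyBounded ((fun x => k * x * k) '' Metric.closedBall (0 : 𝒜) R))
    {r C : ℝ} (hr : 0 ≤ r) (hC : ∀ n, ∀ s ∈ sandwichSet S k r ^ n, ‖s‖ ≤ C)
    (hlow : ∀ n, ∃ s ∈ sandwichSet S k r ^ n, 1 / 2 ≤ ‖s‖) :
    ∃ e ∈ S, e * e = e ∧ e ≠ 0 := by
  obtain ⟨M, hM⟩ : ∃ M, M = sandwichSet S k r := ⟨_, rfl⟩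
  have hC0 : 0 ≤ C := (norm_nonneg _).trans (hC 0 1 (by simp))
  let W : Set 𝒜 := ⋃ n : ℕ, M ^ (n + 1)
  have hWmul : ∀ a ∈ W, ∀ b ∈ W, a * b ∈ W := by
    intro a ha b hb
    obtain ⟨i, hi⟩ := Set.mem_iUnion.1 ha
    obtain ⟨j, hj⟩ := Set.mem_iUnion.1 hb
    refine Set.mem_iUnion.2 ⟨i + 1 + j, ?_⟩
    rw [add_assoc, pow_add]
    exact Set.mul_mem_mul hi hj
  have hWS : W ⊆ S := Set.iUnion_subset fun n => hM ▸ sandwichSet_pow_succ_subset hmul hk n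
  have hWtb : TotallyBounded W := by
    refine (htb (max r (r * (‖k‖ * C * ‖k‖) * r))).subset (Set.iUnion_subset fun n => ?_)
    rintro s hs
    rcases n with _ | n
    · rw [zero_add, pow_one, hM] at hs
      obtain ⟨b, -, hb, rfl⟩ := hs
      exact ⟨b, by simp [hb], rfl⟩
    · rw [hM] at hs
      obtain ⟨b, u, b', hu, hb, hb', rfl⟩ := exists_eq_of_mem_sandwichSet_pow hs
      refine ⟨b * (k * u * k) * b', ?_, by simp only [mul_assoc]⟩
      rw [mem_closedBall_zero_iff]
      refine le_max_of_le_right (norm_mul₃_le.trans ?_)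
      have := norm_mul₃_le (a := k) (b := u) (c := k)
      have := hC n u hu
      gcongr
      refine (norm_mul₃_le).trans ?_
      gcongr
  have hWc : IsCompact (closure W) := hWtb.closure.isCompact_of_isClosed isClosed_closure
  have happrox : ∀ ε > 0, ∃ p ∈ W, ∃ q ∈ W, 1 / 2 ≤ ‖p‖ * C ∧ ‖p - p * q‖ < ε := by
    intro ε hε
    obtain ⟨t, -, ht, hcov⟩ := Metric.finite_approx_of_totallyBounded hWtb (ε / 2) (half_pos hε)
    obtain ⟨s, hs, hs2⟩ := hlow (ht.toFinset.card + 1)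
    rw [← hM] at hs
    obtain ⟨p, hp0, hpn, hp⟩ := exists_initial_of_mem_pow hs
    have hpW : ∀ i, i < ht.toFinset.card + 1 → p (i + 1) ∈ M ^ (i + 1) := fun i hi => by
      obtain ⟨q, hq, hqp⟩ := hp 0 (i + 1) (Nat.zero_le _) hi
      rw [← hqp, hp0, one_mul]
      exact hq
    have hch : ∀ i, ∃ y, i < ht.toFinset.card + 1 → y ∈ t ∧ dist (p (i + 1)) y < ε / 2 := by
      intro i
      by_cases hi : i < ht.toFinset.card + 1
      · obtain ⟨y, hy, hpy⟩ := Set.mem_iUnion₂.1 (hcov (Set.mem_iUnion.2 ⟨i, hpW i hi⟩))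
        exact ⟨y, fun _ => ⟨hy, hpy⟩⟩
      · exact ⟨0, fun h => absurd h hi⟩
    choose y hy using hch
    obtain ⟨i, hi, j, hj, hij, hyij⟩ := Finset.exists_ne_map_eq_of_card_lt_of_maps_to
      (s := Finset.range (ht.toFinset.card + 1)) (t := ht.toFinset) (f := y)
      (by simp) (fun i hi => by
        rw [Finset.mem_coe, Finset.mem_range] at hi
        simpa using (hy i hi).1)
    wlog hlt : i < j generalizing i j
    · exact this j hj i hi hij.symm hyij.symm (by omega)
    rw [Finset.mem_range] at hi hj
    obtain ⟨q, hq, hqp⟩ := hp (i + 1) (j + 1) (by omega) (by omega)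
    obtain ⟨q', hq', hqp'⟩ := hp (i + 1) _ (by omega) le_rfl
    refine ⟨p (i + 1), Set.mem_iUnion.2 ⟨i, hpW i hi⟩, q, Set.mem_iUnion.2 ⟨j - i - 1, ?_⟩, ?_, ?_⟩
    · rwa [show j - i - 1 + 1 = j + 1 - (i + 1) by omega]
    · rw [← hpn, ← hqp'] at hs2
      exact hs2.trans ((norm_mul_le _ _).trans
        (mul_le_mul_of_nonneg_left (hC _ q' (hM ▸ hq')) (norm_nonneg _)))
    · rw [hqp, ← dist_eq_norm]
      have h1 := (hy i hi).2
      have h2 := (hy j hj).2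
      rw [hyij] at h1
      linarith [dist_triangle_right (p (i + 1)) (p (j + 1)) (y j)]
  let K : Set (𝒜 × 𝒜) := (closure W ∩ {p | 1 / 2 ≤ ‖p‖ * C}) ×ˢ closure W
  have hK : IsCompact K :=
    (hWc.inter_right (isClosed_le continuous_const (by fun_prop))).prod hWc
  obtain ⟨⟨p, q⟩, ⟨⟨hp, hpC⟩, hq⟩, hmin⟩ := hK.exists_isMinOn (f := fun x => ‖x.1 - x.1 * x.2‖)
    (by
      obtain ⟨p, hp, q, hq, hpC, -⟩ := happrox 1 one_pos
      exact ⟨(p, q), ⟨subset_closure hp, hpC⟩, subset_closure hq⟩) (by fun_prop)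
  have hpq : p * q = p := by
    by_contra hne
    obtain ⟨p', hp', q', hq', hpC', hlt⟩ := happrox ‖p - p * q‖
      (norm_pos_iff.2 (sub_ne_zero.2 (Ne.symm hne)))
    exact absurd hlt (not_lt.2 (hmin (a := (p', q'))
      ⟨⟨subset_closure hp', hpC'⟩, subset_closure hq'⟩))
  have hcmul : ∀ a ∈ closure W, ∀ b ∈ closure W, a * b ∈ closure W := fun a ha b hb =>
    map_mem_closure₂ continuous_mul ha hb hWmul
  obtain ⟨e, ⟨he, hpe⟩, hee⟩ := exists_idempotent_in_compact_subsemigroup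
    (fun r : 𝒜 => continuous_mul_const r) (closure W ∩ {x | p * x = p}) ⟨q, hq, hpq⟩
    (hWc.inter_right (isClosed_eq (by fun_prop) continuous_const))
    (fun x hx y hy => ⟨hcmul x hx.1 y hy.1, by
      change p * (x * y) = p
      rw [← mul_assoc, show p * x = p from hx.2, show p * y = p from hy.2]⟩)
  refine ⟨e, closure_minimal hWS hS he, hee, fun h => ?_⟩
  have hp0 : p = 0 := by rw [← show p * e = p from hpe, h, mul_zero]
  rw [Set.mem_ofPred_eq, hp0, norm_zero, zero_mul] at hpC
  norm_num at hpC

variable [NormedAlgebra ℂ 𝒜] [NormOneClass 𝒜]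

theorem exists_half_le_norm_of_words_unbounded (hsmul : ∀ c : ℂ, ∀ b ∈ S, c • b ∈ S) {r : ℝ}
    (hr : 0 < r)
    (hunb : ∀ r' > r, ¬ ∃ C, ∀ n, ∀ s ∈ sandwichSet S k r' ^ n, ‖s‖ ≤ C) (n : ℕ) :
    ∃ s ∈ sandwichSet S k r ^ n, 1 / 2 ≤ ‖s‖ := by
  by_contra! h
  have hn : n ≠ 0 := by
    rintro rfl
    have := h 1 (by simp)
    rw [norm_one] at this
    norm_num at this
  obtain ⟨c, hc1, hcn⟩ : ∃ c : ℝ, 1 < c ∧ c ^ n = 2 :=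
    ⟨2 ^ (n : ℝ)⁻¹, Real.one_lt_rpow one_lt_two (by positivity),
      Real.rpow_inv_natCast_pow zero_le_two hn⟩
  have hc0 : 0 < c := by linarith
  have hcr : r < c * r := by nlinarith
  refine hunb (c * r) hcr ⟨(1 + ‖k‖ * (c * r) * ‖k‖) ^ n, fun m => ?_⟩
  have hκ : 1 ≤ 1 + ‖k‖ * (c * r) * ‖k‖ := le_add_of_nonneg_right (by positivity)
  have hword : ∀ s ∈ sandwichSet S k (c * r) ^ n, ‖s‖ ≤ 1 := by
    intro s hs
    have h1 := smul_mem_sandwichSet_pow hsmul (inv_nonneg.2 hc0.le) hs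
    rw [inv_mul_cancel_left₀ hc0.ne'] at h1
    have h2 := (h _ h1).le
    rw [norm_smul, norm_pow, Complex.norm_real, Real.norm_of_nonneg (inv_nonneg.2 hc0.le), inv_pow,
      hcn] at h2
    linarith
  induction m using Nat.strong_induction_on with
  | _ m ih =>
    intro s hs
    rcases Nat.lt_or_ge m n with hm | hm
    · refine (norm_le_of_mem_sandwichSet_pow (by positivity) hs).trans ?_
      exact (pow_le_pow_left₀ (by positivity) (by linarith) m).trans
        (pow_le_pow_right₀ hκ hm.le)
    · obtain ⟨l, rfl⟩ := Nat.exists_eq_add_of_le hm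
      rw [pow_add] at hs
      obtain ⟨u, hu, v, hv, rfl⟩ := hs
      calc ‖u * v‖ ≤ ‖u‖ * ‖v‖ := norm_mul_le _ _
        _ ≤ 1 * (1 + ‖k‖ * (c * r) * ‖k‖) ^ n := by
          gcongr
          · exact hword u hu
          · exact ih l (by omega) v hv
        _ = _ := one_mul _

theorem exists_small_mul_mul_of_words_unbounded (hsmul : ∀ c : ℂ, ∀ b ∈ S, c • b ∈ S) {r : ℝ}
    (hr : 0 < r) (hunb : ¬ ∃ C, ∀ n, ∀ s ∈ sandwichSet S k r ^ n, ‖s‖ ≤ C)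
    (hbd : ∀ r' < r, 0 < r' → ∃ C, ∀ n, ∀ s ∈ sandwichSet S k r' ^ n, ‖s‖ ≤ C) {N : ℝ}
    (hN : 2 * (1 + ‖k‖ * r * ‖k‖) ≤ N) :
    ∃ z ∈ (fun x => k * x * k) '' Metric.closedBall (0 : 𝒜) 1, 1 / 2 ≤ (‖k‖ * r) ^ 2 * ‖z‖ ∧
      ∀ b ∈ S, N * (r * ‖z * b * z‖) ≤ 2 * ‖k‖ ^ 2 * (‖b‖ + 1) := by
  have hN0 : 0 < N := lt_of_lt_of_le (by positivity) hN
  obtain ⟨r', hr'r, hrr', n₀, s₀, hs₀, hNs₀⟩ : ∃ r' < r, r / 2 < r' ∧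
      ∃ n, ∃ s ∈ sandwichSet S k r' ^ n, N < ‖s‖ := by
    push Not at hunb
    obtain ⟨n, s, hs, hNs⟩ := hunb N
    have h1 : ∀ᶠ c : ℝ in 𝓝[<] 1, N < c ^ n * ‖s‖ := by
      have : Tendsto (fun c : ℝ => c ^ n * ‖s‖) (𝓝 1) (𝓝 (1 ^ n * ‖s‖)) :=
        Continuous.tendsto (by fun_prop) 1
      rw [one_pow, one_mul] at this
      exact (this.mono_left nhdsWithin_le_nhds).eventually (lt_mem_nhds hNs)
    have h2 : ∀ᶠ c : ℝ in 𝓝[<] 1, 1 / 2 < c :=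
      nhdsWithin_le_nhds (lt_mem_nhds (by norm_num))
    obtain ⟨c, ⟨hc1, hc2⟩, hc3⟩ := ((h1.and h2).and self_mem_nhdsWithin).exists
    have hc0 : 0 < c := by linarith
    refine ⟨c * r, by nlinarith, by nlinarith, n, _, smul_mem_sandwichSet_pow hsmul hc0.le hs, ?_⟩
    rwa [norm_smul, norm_pow, Complex.norm_real, Real.norm_of_nonneg hc0.le]
  have hr'0 : 0 < r' := by linarith
  obtain ⟨C, hC⟩ := hbd r' hr'r hr'0
  let Z : Set ℝ := {x | ∃ n, ∃ s ∈ sandwichSet S k r' ^ n, ‖s‖ = x}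
  have hZ : BddAbove Z := ⟨C, by rintro _ ⟨n, s, hs, rfl⟩; exact hC n s hs⟩
  obtain ⟨c, hc⟩ : ∃ c, c = sSup Z := ⟨_, rfl⟩
  have hle : ∀ n, ∀ s ∈ sandwichSet S k r' ^ n, ‖s‖ ≤ c := fun n s hs =>
    hc ▸ le_csSup hZ ⟨n, s, hs, rfl⟩
  have hNc : N < c := hNs₀.trans_le (hle _ _ hs₀)
  have hc0 : 0 < c := hN0.trans hNc
  obtain ⟨_, ⟨n, s, hs, rfl⟩, hcs⟩ : ∃ x ∈ Z, c / 2 < x :=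
    exists_lt_of_lt_csSup ⟨_, n₀, s₀, hs₀, rfl⟩ (hc ▸ half_lt_self hc0)
  have hκ : ‖k‖ * r' * ‖k‖ ≤ ‖k‖ * r * ‖k‖ := by gcongr
  have hκ0 : 0 ≤ ‖k‖ * r * ‖k‖ := by positivity
  obtain ⟨l, rfl⟩ : ∃ l, n = l + 2 := by
    have h1 := norm_le_of_mem_sandwichSet_pow hr'0.le hs
    rcases n with _ | _ | l
    · rw [pow_zero] at h1; linarith
    · rw [zero_add, pow_one] at h1; linarith
    · exact ⟨l, rfl⟩
  obtain ⟨b₁, u, b₂, hu, hb₁, hb₂, rfl⟩ := exists_eq_of_mem_sandwichSet_pow hs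
  have hcu := hle _ _ hu
  have hnc : ‖(c : ℂ)⁻¹‖ = c⁻¹ := by
    rw [norm_inv, Complex.norm_real, Real.norm_of_nonneg hc0.le]
  have hz : k * ((c : ℂ)⁻¹ • u) * k = (c : ℂ)⁻¹ • (k * u * k) := by
    rw [mul_smul_comm, smul_mul_assoc]
  refine ⟨_, ⟨(c : ℂ)⁻¹ • u, ?_, rfl⟩, ?_, fun b hb => ?_⟩
  · rw [mem_closedBall_zero_iff, norm_smul, hnc]
    exact (inv_mul_le_one₀ hc0).2 hcu
  · have h1 : ‖k * b₁ * (k * u * k) * b₂ * k‖ ≤ (‖k‖ * r) ^ 2 * ‖k * u * k‖ := by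
      calc ‖k * b₁ * (k * u * k) * b₂ * k‖ ≤ ‖k‖ * ‖b₁‖ * ‖k * u * k‖ * ‖b₂‖ * ‖k‖ := by
            refine (norm_mul_le _ _).trans ?_
            gcongr
            refine (norm_mul_le _ _).trans ?_
            gcongr
            exact norm_mul₃_le
        _ ≤ ‖k‖ * r * ‖k * u * k‖ * r * ‖k‖ := by
            have := hb₁.trans hr'r.le
            have := hb₂.trans hr'r.le
            gcongr
        _ = _ := by ring
    simp only [hz]
    rw [norm_smul, hnc, mul_left_comm, inv_mul_eq_div, le_div_iff₀ hc0]
    linarith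
  · simp only [hz]
    have hb0 : 0 < ‖b‖ + 1 := by positivity
    obtain ⟨d, hd⟩ : ∃ d : ℝ, d = r' / (‖b‖ + 1) := ⟨_, rfl⟩
    have hd0 : 0 < d := hd ▸ by positivity
    have hdb : d * (‖b‖ + 1) = r' := by rw [hd]; field_simp
    have hnd : ‖(d : ℂ)‖ = d := by rw [Complex.norm_real, Real.norm_of_nonneg hd0.le]
    have h1 : k * ((d : ℂ) • b) * k ∈ sandwichSet S k r' := by
      refine ⟨_, hsmul _ b hb, ?_, rfl⟩
      rw [norm_smul, hnd]
      nlinarith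
    have h2 := hle _ _ (by
      rw [pow_add, pow_add, pow_one]
      exact Set.mul_mem_mul (Set.mul_mem_mul hu h1) hu : _ ∈ sandwichSet S k r' ^ (l + 1 + l))
    have h3 : u * (k * ((d : ℂ) • b) * k) * u = (d : ℂ) • (u * (k * b * k) * u) := by
      simp only [mul_smul_comm, smul_mul_assoc]
    rw [h3, norm_smul, hnd] at h2
    have h4 : (c : ℂ)⁻¹ • (k * u * k) * b * (c : ℂ)⁻¹ • (k * u * k) =
        ((c : ℂ)⁻¹ * (c : ℂ)⁻¹) • (k * (u * (k * b * k) * u) * k) := by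
      simp only [mul_smul_comm, smul_mul_assoc, smul_smul, mul_assoc]
    have h5 : ‖k * (u * (k * b * k) * u) * k‖ ≤ ‖k‖ * ‖u * (k * b * k) * u‖ * ‖k‖ := norm_mul₃_le
    rw [h4, norm_smul, norm_mul, hnc]
    obtain ⟨x, hx⟩ : ∃ x, x = ‖u * (k * b * k) * u‖ := ⟨_, rfl⟩
    rw [← hx] at h2 h5
    have hx0 : 0 ≤ x := hx ▸ norm_nonneg _
    have h6 : r' * x ≤ c * (‖b‖ + 1) := by
      rw [← hdb]
      nlinarith
    calc N * (r * (c⁻¹ * c⁻¹ * ‖k * (u * (k * b * k) * u) * k‖))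
        ≤ c * (2 * r' * (c⁻¹ * c⁻¹ * (‖k‖ * x * ‖k‖))) := by
          have : r ≤ 2 * r' := by linarith
          gcongr
      _ = 2 * ‖k‖ ^ 2 * c⁻¹ * (r' * x) := by field_simp
      _ ≤ 2 * ‖k‖ ^ 2 * c⁻¹ * (c * (‖b‖ + 1)) := by gcongr
      _ = _ := by field_simp

theorem exists_mul_mul_eq_zero_of_words_unbounded [CompleteSpace 𝒜]
    (hsmul : ∀ c : ℂ, ∀ b ∈ S, c • b ∈ S)
    (htb : ∀ R : ℝ, TotallyBounded ((fun x => k * x * k) '' Metric.closedBall (0 : 𝒜) R)) {r : ℝ}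
    (hr : 0 < r) (hunb : ¬ ∃ C, ∀ n, ∀ s ∈ sandwichSet S k r ^ n, ‖s‖ ≤ C)
    (hbd : ∀ r' < r, 0 < r' → ∃ C, ∀ n, ∀ s ∈ sandwichSet S k r' ^ n, ‖s‖ ≤ C) :
    ∃ z, z ≠ 0 ∧ ∀ b ∈ S, z * b * z = 0 := by
  have hκ0 : 0 ≤ ‖k‖ * r * ‖k‖ := by positivity
  have h : ∀ j : ℕ, 2 * (1 + ‖k‖ * r * ‖k‖) ≤ 2 * (1 + ‖k‖ * r * ‖k‖) + j := fun j =>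
    le_add_of_nonneg_right (Nat.cast_nonneg j)
  choose z hz hz1 hz2 using fun j : ℕ =>
    exists_small_mul_mul_of_words_unbounded hsmul hr hunb hbd (h j)
  obtain ⟨w, -, φ, hφ, hw⟩ :=
    ((htb 1).closure.isCompact_of_isClosed isClosed_closure).tendsto_subseq
    fun j => subset_closure (hz j)
  refine ⟨w, ?_, fun b hb => ?_⟩
  · rintro rfl
    have h1 : Tendsto (fun j => (‖k‖ * r) ^ 2 * ‖z (φ j)‖) atTop (𝓝 ((‖k‖ * r) ^ 2 * ‖(0 : 𝒜)‖)) :=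
      hw.norm.const_mul _
    have h2 := ge_of_tendsto' h1 fun j => hz1 (φ j)
    rw [norm_zero, mul_zero] at h2
    norm_num at h2
  · obtain ⟨D, hD⟩ : ∃ D, D = 2 * ‖k‖ ^ 2 * (‖b‖ + 1) / r := ⟨_, rfl⟩
    have hbound : ∀ j, ‖z (φ j) * b * z (φ j)‖ ≤ D / (j + 1) := fun j => by
      have h1 := hz2 (φ j) b hb
      have h2 : (j : ℝ) ≤ φ j := by exact_mod_cast hφ.id_le j
      rw [hD, div_div, le_div_iff₀ (by positivity)]
      refine le_trans ?_ h1
      have h3 : (j : ℝ) + 1 ≤ 2 * (1 + ‖k‖ * r * ‖k‖) + φ j := by linarith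
      calc _ = ((j : ℝ) + 1) * (r * ‖z (φ j) * b * z (φ j)‖) := by ring
        _ ≤ _ := by gcongr
    have hlim : Tendsto (fun j => z (φ j) * b * z (φ j)) atTop (𝓝 (w * b * w)) :=
      (hw.mul_const b).mul hw
    refine tendsto_nhds_unique hlim (squeeze_zero_norm hbound ?_)
    simpa [div_eq_mul_inv] using (tendsto_one_div_add_atTop_nhds_zero_nat (𝕜 := ℝ)).const_mul D

/-- A closed multiplicative semigroup with a compact sandwich that is not topologically
nilpotent contains a nonzero idempotent, unless it is degenerate. -/
theorem exists_isIdempotentElem_or_mul_mul_eq_zero [CompleteSpace 𝒜] (hS : IsClosed S)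
    (hmul : ∀ a ∈ S, ∀ b ∈ S, a * b ∈ S) (hsmul : ∀ c : ℂ, ∀ b ∈ S, c • b ∈ S) (hk : k ∈ S)
    (htb : ∀ R : ℝ, TotallyBounded ((fun x => k * x * k) '' Metric.closedBall (0 : 𝒜) R))
    {r δ : ℝ} (hr : 0 < r) (hδ : 0 < δ) (hlow : ∀ n, ∃ s ∈ sandwichSet S k r ^ n, δ ≤ ‖s‖) :
    (∃ e ∈ S, e * e = e ∧ e ≠ 0) ∨ ∃ z, z ≠ 0 ∧ ∀ b ∈ S, z * b * z = 0 := by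
  let T : Set ℝ := {t | 0 < t ∧ ∃ C, ∀ n, ∀ s ∈ sandwichSet S k t ^ n, ‖s‖ ≤ C}
  have hTbdd : BddAbove T := by
    refine ⟨r, fun t ⟨ht, C, hC⟩ => ?_⟩
    by_contra! hrt
    have h1 : 1 < t / r := (one_lt_div hr).2 hrt
    obtain ⟨n, hn⟩ := ((tendsto_pow_atTop_atTop_of_one_lt h1).const_mul_atTop hδ)
      |>.eventually_gt_atTop C |>.exists
    obtain ⟨s, hs, hsδ⟩ := hlow n
    have h2 := smul_mem_sandwichSet_pow hsmul (by positivity : 0 ≤ t / r) hs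
    rw [div_mul_cancel₀ _ hr.ne'] at h2
    have h3 := hC n _ h2
    rw [norm_smul, norm_pow, Complex.norm_real, Real.norm_of_nonneg (by positivity)] at h3
    have : (t / r) ^ n * δ ≤ (t / r) ^ n * ‖s‖ := by gcongr
    linarith
  have hTmem : (‖k‖ * ‖k‖ + 1)⁻¹ ∈ T := by
    refine ⟨by positivity, 1, fun n s hs => ?_⟩
    refine (norm_le_of_mem_sandwichSet_pow (by positivity) hs).trans
      (pow_le_one₀ (by positivity) ?_)
    rw [mul_right_comm, ← div_eq_mul_inv, div_le_one (by positivity)]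
    linarith
  have hTdown : ∀ t ∈ T, ∀ t' < t, 0 < t' → t' ∈ T := by
    rintro t ⟨-, C, hC⟩ t' htt' ht'
    refine ⟨ht', C, fun n s hs => hC n s (Set.pow_subset_pow_left ?_ hs)⟩
    rintro _ ⟨b, hb, hbt, rfl⟩
    exact ⟨b, hb, hbt.trans htt'.le, rfl⟩
  have hpos : 0 < sSup T := hTmem.1.trans_le (le_csSup hTbdd hTmem)
  by_cases hT : sSup T ∈ T
  · left
    obtain ⟨-, C, hC⟩ := hT
    refine exists_isIdempotentElem_of_bounded_words hS hmul hk htb hpos.le hC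
      (exists_half_le_norm_of_words_unbounded hsmul hpos fun r' hr' h => ?_)
    exact absurd (le_csSup hTbdd ⟨hpos.trans hr', h⟩) hr'.not_ge
  · right
    refine exists_mul_mul_eq_zero_of_words_unbounded hsmul htb hpos (fun h => hT ⟨hpos, h⟩) ?_
    intro r' hr' hr'0
    obtain ⟨t, ht, hrt⟩ := exists_lt_of_lt_csSup ⟨_, hTmem⟩ hr'
    exact (hTdown t ht r' hrt hr'0).2

end CompactSemigroup

section MultiplicationPairs

variable {X : Type*} [NormedAddCommGroup X] [NormedSpace ℂ X] {J : Submodule ℂ (X →L[ℂ] X)}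

theorem IsCompactOperator.mul_sub_smul_one {u v : X →L[ℂ] X} {ζ ξ : ℂ}
    (hu : IsCompactOperator (u - ζ • (1 : X →L[ℂ] X) : X →L[ℂ] X))
    (hv : IsCompactOperator (v - ξ • (1 : X →L[ℂ] X) : X →L[ℂ] X)) :
    IsCompactOperator (u * v - (ζ * ξ) • (1 : X →L[ℂ] X) : X →L[ℂ] X) := by
  have h : u * v - (ζ * ξ) • (1 : X →L[ℂ] X) =
      (u - ζ • (1 : X →L[ℂ] X)) * v + ζ • (v - ξ • (1 : X →L[ℂ] X)) := by
    rw [sub_mul, smul_mul_assoc, one_mul, smul_sub, smul_smul]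
    abel
  rw [h]
  exact (hu.comp_clm v).add (hv.smul ζ)

/-- The pairs of operators, each congruent to the same nonzero scalar modulo the compact
operators, whose two-sided multiplications preserve `J`. -/
def multiplicationPairs (J : Submodule ℂ (X →L[ℂ] X)) : Set ((X →L[ℂ] X) × (X →L[ℂ] X)ᵐᵒᵖ) :=
  {p | ∃ ζ : ℂ, ζ ≠ 0 ∧ IsCompactOperator (p.1 - ζ • (1 : X →L[ℂ] X) : X →L[ℂ] X) ∧
    IsCompactOperator (p.2.unop - ζ • (1 : X →L[ℂ] X) : X →L[ℂ] X) ∧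
    (∀ x ∈ J, p.1 * x * p.2.unop ∈ J) ∧ ∀ x ∈ J, p.2.unop * x * p.1 ∈ J}

theorem mul_mem_multiplicationPairs {p q : (X →L[ℂ] X) × (X →L[ℂ] X)ᵐᵒᵖ}
    (hp : p ∈ multiplicationPairs J) (hq : q ∈ multiplicationPairs J) :
    p * q ∈ multiplicationPairs J := by
  obtain ⟨ζ, hζ, h1, h2, h3, h4⟩ := hp
  obtain ⟨ξ, hξ, k1, k2, k3, k4⟩ := hq
  refine ⟨ζ * ξ, mul_ne_zero hζ hξ, h1.mul_sub_smul_one k1, ?_, fun x hx => ?_, fun x hx => ?_⟩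
  · rw [mul_comm ζ ξ]
    exact k2.mul_sub_smul_one h2
  · have := h3 _ (k3 x hx)
    simpa only [Prod.fst_mul, Prod.snd_mul, MulOpposite.unop_mul, mul_assoc] using this
  · have := k4 _ (h4 x hx)
    simpa only [Prod.fst_mul, Prod.snd_mul, MulOpposite.unop_mul, mul_assoc] using this

theorem smul_mem_multiplicationPairs {c : ℂ} (hc : c ≠ 0) {p : (X →L[ℂ] X) × (X →L[ℂ] X)ᵐᵒᵖ}
    (hp : p ∈ multiplicationPairs J) : c • p ∈ multiplicationPairs J := by
  obtain ⟨ζ, hζ, h1, h2, h3, h4⟩ := hp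
  refine ⟨c * ζ, mul_ne_zero hc hζ, ?_, ?_, fun x hx => ?_, fun x hx => ?_⟩
  · rw [mul_smul, Prod.smul_fst, ← smul_sub]
    exact h1.smul c
  · rw [mul_smul, Prod.smul_snd, MulOpposite.unop_smul, ← smul_sub]
    exact h2.smul c
  · simp only [Prod.smul_fst, Prod.smul_snd, MulOpposite.unop_smul, smul_mul_assoc, mul_smul_comm]
    exact J.smul_mem _ (J.smul_mem _ (h3 x hx))
  · simp only [Prod.smul_fst, Prod.smul_snd, MulOpposite.unop_smul, smul_mul_assoc, mul_smul_comm]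
    exact J.smul_mem _ (J.smul_mem _ (h4 x hx))

/-- Interchange the two operators of a pair. -/
def swapPair (p : (X →L[ℂ] X) × (X →L[ℂ] X)ᵐᵒᵖ) : (X →L[ℂ] X) × (X →L[ℂ] X)ᵐᵒᵖ :=
  (p.2.unop, MulOpposite.op p.1)

theorem continuous_swapPair : Continuous (swapPair (X := X)) := by
  unfold swapPair
  fun_prop

theorem swapPair_mem_multiplicationPairs {p : (X →L[ℂ] X) × (X →L[ℂ] X)ᵐᵒᵖ}
    (hp : p ∈ multiplicationPairs J) : swapPair p ∈ multiplicationPairs J := by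
  obtain ⟨ζ, hζ, h1, h2, h3, h4⟩ := hp
  exact ⟨ζ, hζ, h2, h1, h4, h3⟩

theorem smul_one_add_mem_multiplicationPairs (hJ : ∀ A ∈ J, ∀ B ∈ J, A * B + B * A ∈ J)
    (hcompact : ∀ A ∈ J, IsCompactOperator A) {a : X →L[ℂ] X} (ha : a ∈ J) {ζ : ℂ} (hζ : ζ ≠ 0) :
    ζ • (1 : (X →L[ℂ] X) × (X →L[ℂ] X)ᵐᵒᵖ) + (a, MulOpposite.op a) ∈ multiplicationPairs J := by
  have h1 : ζ • (1 : X →L[ℂ] X) + a - ζ • (1 : X →L[ℂ] X) = a := add_sub_cancel_left _ _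
  have h2 : ∀ x ∈ J, (ζ • (1 : X →L[ℂ] X) + a) * x * (ζ • (1 : X →L[ℂ] X) + a) ∈ J := by
    intro x hx
    have : (ζ • (1 : X →L[ℂ] X) + a) * x * (ζ • (1 : X →L[ℂ] X) + a) =
        (ζ * ζ) • x + ζ • (a * x + x * a) + a * x * a := by
      simp only [add_mul, mul_add, smul_mul_assoc, mul_smul_comm, one_mul, mul_one, smul_add,
        smul_smul]
      abel
    rw [this]
    exact J.add_mem (J.add_mem (J.smul_mem _ hx) (J.smul_mem _ (hJ a ha x hx)))
      (mul_mul_self_mem_of_jordan hJ ha hx)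
  have h3 : IsCompactOperator (ζ • (1 : X →L[ℂ] X) + a - ζ • (1 : X →L[ℂ] X) : X →L[ℂ] X) := by
    rw [h1]
    exact hcompact a ha
  exact ⟨ζ, hζ, h3, h3, h2, h2⟩

/-- The compact pairs in the closure of `multiplicationPairs J`. -/
def compactMultiplicationPairs (J : Submodule ℂ (X →L[ℂ] X)) :
    Set ((X →L[ℂ] X) × (X →L[ℂ] X)ᵐᵒᵖ) :=
  closure (multiplicationPairs J) ∩ {p | IsCompactOperator p.1 ∧ IsCompactOperator p.2.unop}

theorem isClosed_compactMultiplicationPairs [CompleteSpace X] :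
    IsClosed (compactMultiplicationPairs J) := by
  have h := isClosed_setOfPred_isCompactOperator (σ₁₂ := RingHom.id ℂ) (M₁ := X) (M₂ := X)
  refine isClosed_closure.inter (IsClosed.and (h.preimage continuous_fst) ?_)
  exact h.preimage (MulOpposite.continuous_unop.comp continuous_snd)

theorem mul_mem_compactMultiplicationPairs {p q : (X →L[ℂ] X) × (X →L[ℂ] X)ᵐᵒᵖ}
    (hp : p ∈ compactMultiplicationPairs J) (hq : q ∈ compactMultiplicationPairs J) :
    p * q ∈ compactMultiplicationPairs J :=
  ⟨map_mem_closure₂ continuous_mul hp.1 hq.1 fun _ ha _ hb => mul_mem_multiplicationPairs ha hb,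
    hp.2.1.comp_clm q.1, hq.2.2.comp_clm p.2.unop⟩

theorem smul_mem_compactMultiplicationPairs (c : ℂ) {p : (X →L[ℂ] X) × (X →L[ℂ] X)ᵐᵒᵖ}
    (hp : p ∈ compactMultiplicationPairs J) : c • p ∈ compactMultiplicationPairs J :=
  ⟨map_mem_closure₂ (f := fun (c : ℂ) (p : (X →L[ℂ] X) × (X →L[ℂ] X)ᵐᵒᵖ) => c • p)
    continuous_smul (dense_compl_singleton (0 : ℂ) c) hp.1
    fun _ hc _ hq => smul_mem_multiplicationPairs hc hq, hp.2.1.smul c, hp.2.2.smul c⟩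

theorem swapPair_mem_compactMultiplicationPairs {p : (X →L[ℂ] X) × (X →L[ℂ] X)ᵐᵒᵖ}
    (hp : p ∈ compactMultiplicationPairs J) : swapPair p ∈ compactMultiplicationPairs J :=
  ⟨map_mem_closure continuous_swapPair hp.1 fun _ hq => swapPair_mem_multiplicationPairs hq,
    hp.2.2, hp.2.1⟩

theorem mk_op_mem_compactMultiplicationPairs (hJ : ∀ A ∈ J, ∀ B ∈ J, A * B + B * A ∈ J)
    (hcompact : ∀ A ∈ J, IsCompactOperator A) {a : X →L[ℂ] X} (ha : a ∈ J) :
    (a, MulOpposite.op a) ∈ compactMultiplicationPairs J := by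
  refine ⟨?_, hcompact a ha, hcompact a ha⟩
  have h := map_mem_closure (f := fun ζ : ℂ =>
    ζ • (1 : (X →L[ℂ] X) × (X →L[ℂ] X)ᵐᵒᵖ) + (a, MulOpposite.op a)) (t := multiplicationPairs J)
    (by fun_prop) (dense_compl_singleton (0 : ℂ) 0)
    fun ζ hζ => smul_one_add_mem_multiplicationPairs hJ hcompact ha hζ
  simpa only [zero_smul, zero_add] using h

theorem totallyBounded_mul_mul_pair [CompleteSpace X] {a b : X →L[ℂ] X} (ha : IsCompactOperator a)
    (hb : IsCompactOperator b) (R : ℝ) :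
    TotallyBounded ((fun x => (a, MulOpposite.op b) * x * (a, MulOpposite.op b)) ''
      Metric.closedBall (0 : (X →L[ℂ] X) × (X →L[ℂ] X)ᵐᵒᵖ) R) := by
  have h1 := (ha.totallyBounded_mul_mul R).closure.isCompact_of_isClosed isClosed_closure
  have h2 := (hb.totallyBounded_mul_mul R).closure.isCompact_of_isClosed isClosed_closure
  refine (h1.prod (h2.image MulOpposite.continuous_op)).totallyBounded.subset ?_
  rintro _ ⟨x, hx, rfl⟩
  rw [mem_closedBall_zero_iff] at hx
  refine ⟨subset_closure ⟨x.1, ?_, rfl⟩, _, subset_closure ⟨x.2.unop, ?_, rfl⟩, ?_⟩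
  · rw [mem_closedBall_zero_iff]
    exact (norm_fst_le x).trans hx
  · rw [mem_closedBall_zero_iff]
    exact (norm_snd_le x).trans hx
  · simp [mul_assoc]

end MultiplicationPairs

section ConvexWords

open scoped Pointwise

variable {𝒜 : Type*} [NormedRing 𝒜] {S : Set 𝒜} {k : 𝒜}

theorem sandwichSet_mono {r r' : ℝ} (h : r ≤ r') : sandwichSet S k r ⊆ sandwichSet S k r' :=
  fun _ ⟨b, hb, hbr, hx⟩ => ⟨b, hb, hbr.trans h, hx⟩

variable [NormedAlgebra ℂ 𝒜]

theorem mul_mem_convexHull_mul {A B : Set 𝒜} {x y : 𝒜} (hx : x ∈ convexHull ℝ A)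
    (hy : y ∈ convexHull ℝ B) : x * y ∈ convexHull ℝ (A * B) := by
  have h1 : ∀ b ∈ B, x * b ∈ convexHull ℝ (A * B) := fun b hb => by
    have h : A ⊆ (LinearMap.mulRight ℝ b) ⁻¹' convexHull ℝ (A * B) := fun a ha =>
      subset_convexHull ℝ _ (Set.mul_mem_mul ha hb)
    exact convexHull_min h ((convex_convexHull ℝ _).linear_preimage _) hx
  have h2 : B ⊆ (LinearMap.mulLeft ℝ x) ⁻¹' convexHull ℝ (A * B) := h1
  exact convexHull_min h2 ((convex_convexHull ℝ _).linear_preimage _) hy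

theorem smul_mem_convexHull_sandwichSet (hsmul : ∀ c : ℂ, ∀ b ∈ S, c • b ∈ S) (c : ℂ) {r : ℝ}
    {x : 𝒜} (hx : x ∈ convexHull ℝ (sandwichSet S k r)) :
    c • x ∈ convexHull ℝ (sandwichSet S k (‖c‖ * r)) := by
  have h : sandwichSet S k r ⊆
      (LinearMap.lsmul ℂ 𝒜 c).restrictScalars ℝ ⁻¹' convexHull ℝ (sandwichSet S k (‖c‖ * r)) := by
    rintro _ ⟨b, hb, hbr, rfl⟩
    refine subset_convexHull ℝ _ ⟨c • b, hsmul c b hb, ?_, ?_⟩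
    · rw [norm_smul]
      gcongr
    · rw [mul_smul_comm, smul_mul_assoc]
      rfl
  exact convexHull_min h ((convex_convexHull ℝ _).linear_preimage _) hx

theorem exists_mem_convexHull_sandwichSet_of_mem_span (hsmul : ∀ c : ℂ, ∀ b ∈ S, c • b ∈ S)
    (hk : k ∈ S) {T : 𝒜} (hT : T ∈ Submodule.span ℂ S) :
    ∃ r, k * T * k ∈ convexHull ℝ (sandwichSet S k r) := by
  induction hT using Submodule.span_induction with
  | mem b hb => exact ⟨‖b‖, subset_convexHull ℝ _ ⟨b, hb, le_rfl, rfl⟩⟩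
  | zero =>
    refine ⟨0, subset_convexHull ℝ _ ⟨0, ?_, by simp, rfl⟩⟩
    simpa using hsmul 0 k hk
  | add T T' _ _ h h' =>
    obtain ⟨r, hr⟩ := h
    obtain ⟨r', hr'⟩ := h'
    refine ⟨‖(2 : ℂ)‖ * max r r', ?_⟩
    have h1 := smul_mem_convexHull_sandwichSet hsmul 2
      (convexHull_mono (sandwichSet_mono (le_max_left r r')) hr)
    have h2 := smul_mem_convexHull_sandwichSet hsmul 2
      (convexHull_mono (sandwichSet_mono (le_max_right r r')) hr')
    have h3 := convex_convexHull ℝ _ h1 h2 (a := 1 / 2) (b := 1 / 2) (by norm_num) (by norm_num)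
      (by norm_num)
    convert h3 using 1
    rw [mul_add, add_mul, ← Complex.coe_smul, ← Complex.coe_smul, smul_smul, smul_smul]
    norm_num
  | smul c T _ h =>
    obtain ⟨r, hr⟩ := h
    refine ⟨‖c‖ * r, ?_⟩
    rw [mul_smul_comm, smul_mul_assoc]
    exact smul_mem_convexHull_sandwichSet hsmul c hr

end ConvexWords

section HildenBound

open scoped Pointwise

variable {X : Type*} [NormedAddCommGroup X] [NormedSpace ℂ X] {𝒜 : Type*} [NormedRing 𝒜]
  [NormedAlgebra ℂ 𝒜] {S : Set 𝒜} {k : 𝒜}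

/-- Words in a transitive semigroup sandwiched by a compact operator do not decay rapidly. -/
theorem exists_words_norm_ge (π : 𝒜 →ₐ[ℂ] (X →L[ℂ] X)) (hπ : ∀ a, ‖π a‖ ≤ ‖a‖)
    (hsmul : ∀ c : ℂ, ∀ b ∈ S, c • b ∈ S) (hk : k ∈ S)
    (hcomp : IsCompactOperator (π k)) {x₀ : X} (hx₀ : π k (π k x₀) ≠ 0)
    (hdense : ∀ y : X, y ≠ 0 → ∀ x : X, ∀ ε > 0, ∃ T ∈ Submodule.span ℂ S, ‖π T y - x‖ < ε) :
    ∃ r > 0, ∃ δ > 0, ∀ n, ∃ s ∈ sandwichSet S k r ^ n, δ ≤ ‖s‖ := by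
  obtain ⟨d, hd⟩ : ∃ d, d = ‖π k (π k x₀)‖ / 2 := ⟨_, rfl⟩
  have hd0 : 0 < d := hd ▸ half_pos (norm_pos_iff.2 hx₀)
  obtain ⟨ρ, hρ, hball⟩ : ∃ ρ > 0, ∀ y, ‖y - x₀‖ < ρ → d ≤ ‖π k (π k y)‖ := by
    have hc : Continuous fun y => ‖π k (π k y)‖ := by fun_prop
    have h := hc.continuousAt.eventually (lt_mem_nhds (hd ▸ half_lt_self (norm_pos_iff.2 hx₀) :
      d < ‖π k (π k x₀)‖))
    obtain ⟨ρ, hρ, h⟩ := Metric.eventually_nhds_iff.1 h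
    exact ⟨ρ, hρ, fun y hy => (h (by rwa [dist_eq_norm])).le⟩
  have hQ : IsCompact (closure ((π k * π k) '' Metric.ball x₀ ρ)) :=
    IsCompactOperator.isCompact_closure_image_of_bounded
      (f := ((π k * π k : X →L[ℂ] X) : X →ₗ[ℂ] X)) (hcomp.comp_clm (π k)) Metric.isBounded_ball
  have hQd : ∀ y ∈ closure ((π k * π k) '' Metric.ball x₀ ρ), d ≤ ‖y‖ := by
    refine fun y hy => closure_minimal (t := {y | d ≤ ‖y‖}) ?_
      (isClosed_le continuous_const continuous_norm) hy
    rintro _ ⟨y, hy, rfl⟩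
    exact hball y (by rwa [← dist_eq_norm])
  obtain ⟨r, hr⟩ : ∃ r, ∀ y ∈ closure ((π k * π k) '' Metric.ball x₀ ρ),
      ∃ T : 𝒜, ‖π T y - x₀‖ < ρ ∧
        k * T * k ∈ convexHull ℝ (sandwichSet S k r) := by
    refine hQ.induction_on (p := fun s => ∃ r, ∀ y ∈ s,
      ∃ T : 𝒜, ‖π T y - x₀‖ < ρ ∧
        k * T * k ∈ convexHull ℝ (sandwichSet S k r)) ⟨0, fun y hy => hy.elim⟩
      (fun s t hst ⟨r, hr⟩ => ⟨r, fun y hy => hr y (hst hy)⟩) ?_ ?_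
    · rintro s t ⟨r, hr⟩ ⟨r', hr'⟩
      refine ⟨max r r', fun y hy => ?_⟩
      rcases hy with hy | hy
      · obtain ⟨T, hT, hT'⟩ := hr y hy
        exact ⟨T, hT, convexHull_mono (sandwichSet_mono (le_max_left r r')) hT'⟩
      · obtain ⟨T, hT, hT'⟩ := hr' y hy
        exact ⟨T, hT, convexHull_mono (sandwichSet_mono (le_max_right r r')) hT'⟩
    · intro y hy
      obtain ⟨T, hT, hTy⟩ := hdense y (norm_pos_iff.1 (hd0.trans_le (hQd y hy))) x₀ ρ hρ
      obtain ⟨r, hr⟩ := exists_mem_convexHull_sandwichSet_of_mem_span hsmul hk hT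
      refine ⟨_, mem_nhdsWithin_of_mem_nhds ((isOpen_lt (f := fun y => ‖π T y - x₀‖)
        (by fun_prop) continuous_const).mem_nhds hTy), r, fun z hz => ⟨T, hz, hr⟩⟩
  have hword : ∀ n, ∃ P ∈ convexHull ℝ (sandwichSet S k (max r 1) ^ n), ∃ y,
      ‖y - x₀‖ < ρ ∧ π P (π k x₀) = π k y := by
    intro n
    induction n with
    | zero => exact ⟨1, subset_convexHull ℝ _ (by simp), x₀, by simpa using hρ, by simp⟩
    | succ n ih =>
      obtain ⟨P, hP, y, hy, hPy⟩ := ih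
      obtain ⟨T, hTy, hT⟩ := hr _ (subset_closure ⟨y, by rwa [Metric.mem_ball, dist_eq_norm], rfl⟩)
      refine ⟨k * T * k * P, ?_, _, hTy, ?_⟩
      · rw [pow_succ']
        exact mul_mem_convexHull_mul
          (convexHull_mono (sandwichSet_mono (le_max_left r 1)) hT) hP
      · simp only [map_mul, mul_apply_eq_comp, hPy]
  have hpos : 0 < ‖π k‖ * ‖π k x₀‖ + 1 := by positivity
  refine ⟨max r 1, by positivity, d / (‖π k‖ * ‖π k x₀‖ + 1), by positivity, fun n => ?_⟩
  by_contra! h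
  obtain ⟨P, hP, y, hy, hPy⟩ := hword n
  have hPn : ‖P‖ < d / (‖π k‖ * ‖π k x₀‖ + 1) := by
    have := convexHull_min (fun s hs => mem_ball_zero_iff.2 (h s hs)) (convex_ball _ _) hP
    exact mem_ball_zero_iff.1 this
  rw [lt_div_iff₀ hpos] at hPn
  have h1 : ‖π k (π k y)‖ ≤ ‖π k‖ * (‖P‖ * ‖π k x₀‖) := by
    rw [← hPy]
    refine ((π k).le_opNorm _).trans ?_
    gcongr
    refine ((π P).le_opNorm _).trans ?_
    gcongr
    exact hπ P
  nlinarith [hball y hy, norm_nonneg P]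

end HildenBound

section Transitivity

variable {X : Type*} [NormedAddCommGroup X] [NormedSpace ℂ X] {J : Submodule ℂ (X →L[ℂ] X)}

theorem exists_apply_ne_zero_of_irreducible (hdim : 2 ≤ Module.rank ℂ X)
    (hirr : ∀ M : Submodule ℂ X, IsClosed (M : Set X) → (∀ A ∈ J, ∀ x ∈ M, A x ∈ M) →
      M = ⊥ ∨ M = ⊤) {y : X} (hy : y ≠ 0) : ∃ a ∈ J, a y ≠ 0 := by
  by_contra! h
  have hinv : ∀ A ∈ J, ∀ x ∈ Submodule.span ℂ {y}, A x ∈ Submodule.span ℂ {y} := by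
    intro A hA x hx
    obtain ⟨c, rfl⟩ := Submodule.mem_span_singleton.1 hx
    rw [map_smul, h A hA, smul_zero]
    exact Submodule.zero_mem _
  rcases hirr _ (Submodule.closed_of_finiteDimensional _) hinv with h1 | h1
  · exact hy (Submodule.span_singleton_eq_bot.1 h1)
  · have h2 := rank_span_le (R := ℂ) ({y} : Set X)
    rw [h1, rank_top, Cardinal.mk_singleton] at h2
    exact absurd (hdim.trans h2) (by norm_num)

/-- A multiplicative semigroup lying over an irreducible family has a topologically transitive
linear span. -/
theorem exists_mem_span_norm_apply_sub_lt {𝒜 : Type*} [Ring 𝒜] [Algebra ℂ 𝒜] {S : Set 𝒜}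
    (π : 𝒜 →ₐ[ℂ] (X →L[ℂ] X)) (hdim : 2 ≤ Module.rank ℂ X)
    (hirr : ∀ M : Submodule ℂ X, IsClosed (M : Set X) → (∀ A ∈ J, ∀ x ∈ M, A x ∈ M) →
      M = ⊥ ∨ M = ⊤) (hmul : ∀ a ∈ S, ∀ b ∈ S, a * b ∈ S) (hJS : ∀ a ∈ J, ∃ s ∈ S, π s = a)
    {y : X} (hy : y ≠ 0) (x : X) {ε : ℝ} (hε : 0 < ε) :
    ∃ T ∈ Submodule.span ℂ S, ‖π T y - x‖ < ε := by
  let φ : 𝒜 →ₗ[ℂ] X := { toFun := fun a => π a y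
                         map_add' := fun a b => by rw [map_add]; rfl
                         map_smul' := fun c a => by rw [map_smul]; rfl }
  let M : Submodule ℂ X := ((Submodule.span ℂ S).map φ).topologicalClosure
  have hinv : ∀ A ∈ J, ∀ x ∈ M, A x ∈ M := by
    intro A hA x hx
    obtain ⟨s, hs, rfl⟩ := hJS A hA
    refine map_mem_closure (π s).continuous hx ?_
    rintro _ ⟨T, hT, rfl⟩
    refine ⟨s * T, ?_, ?_⟩
    · have h : Submodule.span ℂ S ≤ (Submodule.span ℂ S).comap (LinearMap.mulLeft ℂ s) :=
        Submodule.span_le.2 fun b hb => Submodule.subset_span (hmul s hs b hb)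
      exact h hT
    · change π (s * T) y = _
      rw [map_mul]
      rfl
  have hM : M = ⊤ := by
    refine (hirr M (Submodule.isClosed_topologicalClosure _) hinv).resolve_left fun h => ?_
    obtain ⟨a, ha, hay⟩ := exists_apply_ne_zero_of_irreducible hdim hirr hy
    obtain ⟨s, hs, rfl⟩ := hJS a ha
    refine hay ((Submodule.mem_bot ℂ).1 (h ▸ ?_))
    exact Submodule.le_topologicalClosure _ ⟨s, Submodule.subset_span hs, rfl⟩
  obtain ⟨_, ⟨T, hT, rfl⟩, hTx⟩ := Metric.mem_closure_iff.1 (hM ▸ Submodule.mem_top : x ∈ M) ε hε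
  refine ⟨T, hT, ?_⟩
  rwa [dist_comm, dist_eq_norm] at hTx

theorem exists_mul_self_apply_ne_zero (hdim : 2 ≤ Module.rank ℂ X)
    (hirr : ∀ M : Submodule ℂ X, IsClosed (M : Set X) → (∀ A ∈ J, ∀ x ∈ M, A x ∈ M) →
      M = ⊥ ∨ M = ⊤) : ∃ K ∈ J, ∃ x, K (K x) ≠ 0 := by
  by_contra! h
  have hanti : ∀ a ∈ J, ∀ b ∈ J, ∀ x, a (b x) + b (a x) = 0 := by
    intro a ha b hb x
    have h1 := h (a + b) (J.add_mem ha hb) x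
    simp only [add_apply, map_add, h a ha, h b hb, zero_add, add_zero] at h1
    rwa [add_comm] at h1
  have : Nontrivial X := by
    refine rank_pos_iff_nontrivial.1 (lt_of_lt_of_le ?_ hdim)
    norm_num
  obtain ⟨y, hy⟩ := exists_ne (0 : X)
  obtain ⟨a, ha, hay⟩ := exists_apply_ne_zero_of_irreducible hdim hirr hy
  have hinv : ∀ b ∈ J, ∀ x ∈ LinearMap.ker (a : X →ₗ[ℂ] X),
      b x ∈ LinearMap.ker (a : X →ₗ[ℂ] X) := by
    intro b hb x hx
    have hx' : a x = 0 := hx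
    have h2 := hanti a ha b hb x
    rw [hx', map_zero, add_zero] at h2
    exact h2
  rcases hirr _ a.isClosed_ker hinv with h1 | h1
  · exact hay ((Submodule.mem_bot ℂ).1 (h1 ▸ (h a ha y : a y ∈ LinearMap.ker (a : X →ₗ[ℂ] X))))
  · exact hay (h1 ▸ Submodule.mem_top : y ∈ LinearMap.ker (a : X →ₗ[ℂ] X))

theorem exists_idempotent_mem_compactMultiplicationPairs [CompleteSpace X]
    (hdim : 2 ≤ Module.rank ℂ X)
    (hJ : ∀ A ∈ J, ∀ B ∈ J, A * B + B * A ∈ J) (hcompact : ∀ A ∈ J, IsCompactOperator A)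
    (hirr : ∀ M : Submodule ℂ X, IsClosed (M : Set X) → (∀ A ∈ J, ∀ x ∈ M, A x ∈ M) →
      M = ⊥ ∨ M = ⊤) :
    ∃ e ∈ compactMultiplicationPairs J, e * e = e ∧ e.2.unop ≠ 0 := by
  have : Nontrivial X := by
    refine rank_pos_iff_nontrivial.1 (lt_of_lt_of_le ?_ hdim)
    norm_num
  let π := AlgHom.fst ℂ (X →L[ℂ] X) (X →L[ℂ] X)ᵐᵒᵖ
  have hdense : ∀ y : X, y ≠ 0 → ∀ x : X, ∀ ε > 0,
      ∃ T ∈ Submodule.span ℂ (compactMultiplicationPairs J), ‖π T y - x‖ < ε :=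
    fun y hy x ε hε => exists_mem_span_norm_apply_sub_lt π hdim hirr
      (fun _ ha _ hb => mul_mem_compactMultiplicationPairs ha hb)
      (fun a ha => ⟨_, mk_op_mem_compactMultiplicationPairs hJ hcompact ha, rfl⟩) hy x hε
  obtain ⟨K, hK, x₀, hx₀⟩ := exists_mul_self_apply_ne_zero hdim hirr
  have hk := mk_op_mem_compactMultiplicationPairs hJ hcompact hK
  have hsmul : ∀ c : ℂ, ∀ b ∈ compactMultiplicationPairs J,
    c • b ∈ compactMultiplicationPairs J := fun c _ hb => smul_mem_compactMultiplicationPairs c hb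
  obtain ⟨r, hr, δ, hδ, hlow⟩ := exists_words_norm_ge π (fun a => norm_fst_le a) hsmul hk
    (hcompact K hK) hx₀ hdense
  rcases exists_isIdempotentElem_or_mul_mul_eq_zero isClosed_compactMultiplicationPairs
    (fun _ ha _ hb => mul_mem_compactMultiplicationPairs ha hb) hsmul hk
    (totallyBounded_mul_mul_pair (hcompact K hK) (hcompact K hK)) hr hδ hlow with h | h
  · obtain ⟨e, he, hee, he0⟩ := h
    by_cases he2 : e.2.unop = 0
    · refine ⟨swapPair e, swapPair_mem_compactMultiplicationPairs he, ?_, fun h => he0 ?_⟩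
      · have h1 : e.1 * e.1 = e.1 := congrArg Prod.fst hee
        have h2 : e.2 * e.2 = e.2 := congrArg Prod.snd hee
        exact Prod.ext (congrArg MulOpposite.unop h2) (congrArg MulOpposite.op h1)
      · exact Prod.ext h (MulOpposite.unop_injective he2)
    · exact ⟨e, he, hee, he2⟩
  · exfalso
    have hzero : ∀ z : X →L[ℂ] X,
        (∀ b ∈ compactMultiplicationPairs J, z * b.1 * z = 0) → z = 0 := by
      intro z hz
      by_contra hz0
      obtain ⟨y, hy⟩ : ∃ y, z y ≠ 0 := by
        by_contra! h
        exact hz0 (ContinuousLinearMap.ext h)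
      let L : ((X →L[ℂ] X) × (X →L[ℂ] X)ᵐᵒᵖ) →ₗ[ℂ] X :=
        { toFun := fun T => z (T.1 (z y))
          map_add' := fun S T => map_add z _ _
          map_smul' := fun c T => map_smul z _ _ }
      have hspan : Submodule.span ℂ (compactMultiplicationPairs J) ≤ LinearMap.ker L :=
        Submodule.span_le.2 fun b hb => DFunLike.congr_fun (hz b hb) y
      have hclosure : ∀ x, z x = 0 := by
        intro x
        have h1 : x ∈ closure {x | z x = 0} := by
          refine Metric.mem_closure_iff.2 fun ε hε => ?_
          obtain ⟨T, hT, hTx⟩ := hdense _ hy x ε hε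
          refine ⟨π T (z y), hspan hT, ?_⟩
          rwa [dist_comm, dist_eq_norm]
        exact (isClosed_eq z.continuous continuous_const).closure_subset h1
      exact hy (hclosure y)
    obtain ⟨z, hz0, hz⟩ := h
    refine hz0 (Prod.ext (hzero _ fun b hb => congrArg Prod.fst (hz b hb)) ?_)
    refine MulOpposite.unop_injective (hzero _ fun b hb => ?_)
    have h1 := congrArg Prod.snd (hz _ (swapPair_mem_compactMultiplicationPairs hb))
    have h2 := congrArg MulOpposite.unop h1
    rw [mul_assoc]
    exact h2

end Transitivity

section IrreducibleCase

variable {X : Type*} [NormedAddCommGroup X] [NormedSpace ℂ X]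

theorem norm_le_of_near_idempotent {q c : X →L[ℂ] X} (hq : q * q = q) {η : ℝ}
    (hη : (1 + 3 * ‖q‖) * (3 * η) ≤ 1) (hcq : ‖c - q‖ ≤ η) {z : ℂ} (hz : ‖z - 1‖ = 1 / 2) (u : X) :
    ‖u‖ ≤ 2 * (1 + 3 * ‖q‖) * ‖u - z • c u‖ := by
  have hz1 : ‖z‖ ≤ 3 / 2 := by
    calc ‖z‖ = ‖(z - 1) + 1‖ := by rw [sub_add_cancel]
      _ ≤ ‖z - 1‖ + ‖(1 : ℂ)‖ := norm_add_le _ _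
      _ = 3 / 2 := by rw [hz, norm_one]; norm_num
  have hz0 : z - 1 ≠ 0 := norm_pos_iff.1 (by rw [hz]; norm_num)
  have hqq : ∀ w, q (q w) = q w := fun w => DFunLike.congr_fun hq w
  have h1 : u = (u - z • q u) - (z / (z - 1)) • q (u - z • q u) := by
    have h2 : q (u - z • q u) = -(z - 1) • q u := by
      rw [map_sub, map_smul, hqq, neg_smul, sub_smul, one_smul, neg_sub]
    rw [h2, smul_smul, mul_neg, div_mul_cancel₀ _ hz0, neg_smul, sub_neg_eq_add, sub_add_cancel]
  have h3 : ‖z / (z - 1)‖ ≤ 3 := by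
    rw [norm_div, hz, div_le_iff₀ (by norm_num)]
    linarith
  have h4 : ‖u‖ ≤ (1 + 3 * ‖q‖) * ‖u - z • q u‖ := by
    calc ‖u‖ = ‖(u - z • q u) - (z / (z - 1)) • q (u - z • q u)‖ := by rw [← h1]
      _ ≤ ‖u - z • q u‖ + ‖z / (z - 1)‖ * ‖q (u - z • q u)‖ := by
        rw [← norm_smul]
        exact norm_sub_le _ _
      _ ≤ ‖u - z • q u‖ + 3 * (‖q‖ * ‖u - z • q u‖) := by
        gcongr
        exact q.le_opNorm _
      _ = _ := by ring
  have h5 : ‖u - z • q u‖ ≤ ‖u - z • c u‖ + 3 / 2 * (η * ‖u‖) := by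
    calc ‖u - z • q u‖ = ‖(u - z • c u) + z • (c - q) u‖ := by
          congr 1
          change _ = u - z • c u + z • (c u - q u)
          rw [smul_sub]
          abel
      _ ≤ ‖u - z • c u‖ + ‖z‖ * ‖(c - q) u‖ := by
        rw [← norm_smul]
        exact norm_add_le _ _
      _ ≤ _ := by
        gcongr
        exact ((c - q).le_opNorm u).trans (by gcongr)
  have h6 : 0 ≤ 1 + 3 * ‖q‖ := by positivity
  nlinarith [mul_le_mul_of_nonneg_left h5 h6, mul_le_mul_of_nonneg_right hη (norm_nonneg u)]

/-- An operator near a nonzero idempotent has a spectral value near `1`. -/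
theorem exists_not_isUnit_of_near_idempotent [CompleteSpace X] {q c : X →L[ℂ] X} (hq : q * q = q)
    (hq0 : q ≠ 0) {η : ℝ} (hη : (1 + 3 * ‖q‖) * (4 * η) ≤ 1) (hcq : ‖c - q‖ ≤ η) :
    ∃ z : ℂ, z ≠ 0 ∧ ¬ IsUnit (1 - z • c) := by
  by_contra! h
  have hη0 : 0 ≤ η := (norm_nonneg _).trans hcq
  have hunit : ∀ z : ℂ, IsUnit (1 - z • c) := fun z => by
    rcases eq_or_ne z 0 with rfl | hz
    · simp
    · exact h z hz
  obtain ⟨w, hw⟩ : ∃ w, q w ≠ 0 := by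
    by_contra! h
    exact hq0 (ContinuousLinearMap.ext h)
  obtain ⟨v, hv⟩ : ∃ v, v = q w := ⟨_, rfl⟩
  have hqv : q v = v := hv ▸ DFunLike.congr_fun hq w
  have hv0 : 0 < ‖v‖ := norm_pos_iff.2 (hv ▸ hw)
  let f : ℂ → X := fun z => (1 - z) • (Ring.inverse (1 - z • c) : X →L[ℂ] X) v - v
  have hf : Differentiable ℂ f := by
    intro z
    have h1 : DifferentiableAt ℂ (fun z : ℂ => (Ring.inverse (1 - z • c) : X →L[ℂ] X)) z :=
      DifferentiableAt.comp (g := Ring.inverse) z (differentiableAt_inverse (hunit z))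
        ((differentiableAt_const _).sub (differentiableAt_id.smul_const c))
    exact (((differentiableAt_const _).sub differentiableAt_id).smul
      (h1.clm_apply (differentiableAt_const v))).sub_const v
  have hsph : ∀ z ∈ Metric.sphere (1 : ℂ) (1 / 2),
      ‖f z‖ ≤ 3 * (1 + 3 * ‖q‖) * (η * ‖v‖) := by
    intro z hz
    rw [mem_sphere_iff_norm] at hz
    have hz1 : ‖z‖ ≤ 3 / 2 := by
      calc ‖z‖ = ‖(z - 1) + 1‖ := by rw [sub_add_cancel]
        _ ≤ ‖z - 1‖ + ‖(1 : ℂ)‖ := norm_add_le _ _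
        _ = 3 / 2 := by rw [hz, norm_one]; norm_num
    have h6 : 0 ≤ 1 + 3 * ‖q‖ := by positivity
    refine (norm_le_of_near_idempotent hq (by nlinarith) hcq hz (f z)).trans ?_
    have h1 : f z - z • c (f z) = z • (c - q) v := by
      have h2 : (Ring.inverse (1 - z • c) : X →L[ℂ] X) v -
          z • c ((Ring.inverse (1 - z • c) : X →L[ℂ] X) v) = v :=
        DFunLike.congr_fun (Ring.mul_inverse_cancel _ (hunit z)) v
      obtain ⟨y, hy⟩ : ∃ y, y = (Ring.inverse (1 - z • c) : X →L[ℂ] X) v := ⟨_, rfl⟩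
      rw [← hy] at h2
      change (1 - z) • (Ring.inverse (1 - z • c) : X →L[ℂ] X) v - v -
        z • c ((1 - z) • (Ring.inverse (1 - z • c) : X →L[ℂ] X) v - v) = z • (c v - q v)
      rw [← hy, map_sub, map_smul, hqv]
      calc (1 - z) • y - v - z • ((1 - z) • c y - c v) =
            (1 - z) • (y - z • c y) - v + z • c v := by
              simp only [smul_sub, smul_smul, mul_comm z]
              abel
        _ = _ := by
              rw [h2, sub_smul, one_smul, smul_sub]
              abel
    rw [h1, norm_smul]
    calc 2 * (1 + 3 * ‖q‖) * (‖z‖ * ‖(c - q) v‖)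
        ≤ 2 * (1 + 3 * ‖q‖) * (3 / 2 * (η * ‖v‖)) := by
          gcongr
          exact ((c - q).le_opNorm v).trans (by gcongr)
      _ = _ := by ring
  have hmax := Complex.norm_le_of_forall_mem_frontier_norm_le (U := Metric.ball (1 : ℂ) (1 / 2))
    Metric.isBounded_ball hf.diffContOnCl
    (fun z hz => hsph z (Metric.frontier_ball_subset_sphere hz))
    (subset_closure (Metric.mem_ball_self (by norm_num)))
  have h1 : f 1 = -v := by simp [f]
  rw [h1, norm_neg] at hmax
  nlinarith

theorem IsCompactOperator.exists_pos_le_norm_one_sub [CompleteSpace X]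
    (hX : ¬ FiniteDimensional ℂ X) :
    ∃ d > 0, ∀ T : X →L[ℂ] X, IsCompactOperator T → d ≤ ‖1 - T‖ := by
  have hcl := isClosed_setOfPred_isCompactOperator (σ₁₂ := RingHom.id ℂ) (M₁ := X) (M₂ := X)
  have h1 : (1 : X →L[ℂ] X) ∉ {f : X →L[ℂ] X | IsCompactOperator f} := fun h =>
    hX (isCompactOperator_id_iff_finiteDimensional.1 h)
  obtain ⟨d, hd, hball⟩ := Metric.isOpen_iff.1 hcl.isOpen_compl _ h1
  refine ⟨d, hd, fun T hT => ?_⟩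
  by_contra! hlt
  exact hball (by rwa [Metric.mem_ball, dist_comm, dist_eq_norm] : T ∈ Metric.ball 1 d) hT

variable {J : Submodule ℂ (X →L[ℂ] X)}

theorem exists_eigenvector_of_mem_compactMultiplicationPairs [CompleteSpace X]
    (hX : ¬ FiniteDimensional ℂ X) {e : (X →L[ℂ] X) × (X →L[ℂ] X)ᵐᵒᵖ}
    (he : e ∈ compactMultiplicationPairs J) (hee : e * e = e) (he0 : e.2.unop ≠ 0) :
    ∃ c d : X →L[ℂ] X, IsCompactOperator c ∧ IsCompactOperator d ∧
      (∀ x ∈ J, (1 + c) * x * (1 + d) ∈ J) ∧ ∃ v : X, v ≠ 0 ∧ ∃ ν : ℂ, ν ≠ 0 ∧ d v = ν • v := by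
  obtain ⟨δ, hδ, hdist⟩ := IsCompactOperator.exists_pos_le_norm_one_sub hX
  obtain ⟨q, hq⟩ : ∃ q, q = e.2.unop := ⟨_, rfl⟩
  have hqq : q * q = q := by
    rw [hq]
    exact congrArg MulOpposite.unop (congrArg Prod.snd hee)
  obtain ⟨η, hη0, hη⟩ : ∃ η : ℝ, 0 < η ∧ (1 + 3 * ‖q‖) * (4 * η) = 1 :=
    ⟨(4 * (1 + 3 * ‖q‖))⁻¹, by positivity, by field_simp⟩
  have hpos : 0 < 1 + ‖(1 : X →L[ℂ] X)‖ / δ := by positivity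
  obtain ⟨ε, hε0, hε⟩ : ∃ ε : ℝ, 0 < ε ∧ ε * (1 + ‖(1 : X →L[ℂ] X)‖ / δ) = η :=
    ⟨η / (1 + ‖(1 : X →L[ℂ] X)‖ / δ), by positivity, div_mul_cancel₀ _ hpos.ne'⟩
  obtain ⟨p, ⟨ζ, hζ, hp1, hp2, hp, -⟩, hpe⟩ := Metric.mem_closure_iff.1 he.1 ε hε0
  have hpq : ‖p.2.unop - q‖ ≤ ε := by
    rw [dist_comm, dist_eq_norm] at hpe
    rw [hq]
    exact (norm_snd_le (p - e)).trans hpe.le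
  obtain ⟨c, hc⟩ : ∃ c, c = p.2.unop - ζ • (1 : X →L[ℂ] X) := ⟨_, rfl⟩
  rw [← hc] at hp2
  have hqc : IsCompactOperator q := hq ▸ he.2.2
  have hζε : ‖ζ‖ * δ ≤ ε := by
    have h1 : IsCompactOperator (ζ⁻¹ • (q - c) : X →L[ℂ] X) := (hqc.sub hp2).smul ζ⁻¹
    have h2 : ζ • ((1 : X →L[ℂ] X) - ζ⁻¹ • (q - c)) = p.2.unop - q := by
      rw [smul_sub, smul_inv_smul₀ hζ, hc]
      abel
    calc ‖ζ‖ * δ ≤ ‖ζ‖ * ‖(1 : X →L[ℂ] X) - ζ⁻¹ • (q - c)‖ := by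
          gcongr
          exact hdist _ h1
      _ = ‖p.2.unop - q‖ := by rw [← norm_smul, h2]
      _ ≤ ε := hpq
  have hcq : ‖c - q‖ ≤ η := by
    calc ‖c - q‖ = ‖(p.2.unop - q) - ζ • (1 : X →L[ℂ] X)‖ := by
          rw [hc]
          congr 1
          abel
      _ ≤ ‖p.2.unop - q‖ + ‖ζ‖ * ‖(1 : X →L[ℂ] X)‖ := by
        rw [← norm_smul]
        exact norm_sub_le _ _
      _ ≤ ε + ε / δ * ‖(1 : X →L[ℂ] X)‖ := by
        gcongr
        rwa [le_div_iff₀ hδ]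
      _ = η := by rw [← hε]; ring
  obtain ⟨z, hz0, hz⟩ := exists_not_isUnit_of_near_idempotent hqq (hq ▸ he0) hη.le hcq
  have hspec : z⁻¹ ∈ spectrum ℂ c := by
    rw [spectrum.mem_iff]
    intro h
    have h1 := h.smul (Units.mk0 z hz0)
    refine hz ?_
    convert h1 using 1
    rw [Units.smul_def, Units.val_mk0, Algebra.algebraMap_eq_smul_one, smul_sub,
      smul_inv_smul₀ hz0]
  obtain ⟨v, hv⟩ := ((hp2.hasEigenvalue_iff_mem_spectrum (inv_ne_zero hz0)).2
    hspec).exists_hasEigenvector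
  have hcv : c v = z⁻¹ • v := hv.apply_eq_smul
  refine ⟨ζ⁻¹ • (p.1 - ζ • (1 : X →L[ℂ] X)), ζ⁻¹ • c, hp1.smul _, hp2.smul _, fun x hx => ?_, v,
    hv.2, ζ⁻¹ * z⁻¹, mul_ne_zero (inv_ne_zero hζ) (inv_ne_zero hz0), ?_⟩
  · have h1 : ∀ u : X →L[ℂ] X, 1 + ζ⁻¹ • (u - ζ • (1 : X →L[ℂ] X)) = ζ⁻¹ • u := fun u => by
      rw [smul_sub, inv_smul_smul₀ hζ]
      abel
    rw [hc, h1, h1]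
    simp only [smul_mul_assoc, mul_smul_comm]
    exact J.smul_mem _ (J.smul_mem _ (hp x hx))
  · change ζ⁻¹ • c v = _
    rw [hcv, smul_smul]

/-- An irreducible closed Jordan algebra of compact operators contains a nonzero finite-rank
operator. -/
theorem exists_finiteRank_of_irreducible [CompleteSpace X] (hdim : 2 ≤ Module.rank ℂ X)
    (hclosed : IsClosed (J : Set (X →L[ℂ] X)))
    (hJ : ∀ A ∈ J, ∀ B ∈ J, A * B + B * A ∈ J) (hcompact : ∀ A ∈ J, IsCompactOperator A)
    (hirr : ∀ M : Submodule ℂ X, IsClosed (M : Set X) → (∀ A ∈ J, ∀ x ∈ M, A x ∈ M) →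
      M = ⊥ ∨ M = ⊤) :
    ∃ F ∈ J, FiniteDimensional ℂ (LinearMap.range (F : X →ₗ[ℂ] X)) ∧ F ≠ 0 := by
  by_contra! hfr
  have hX : ¬ FiniteDimensional ℂ X := by
    intro hX
    obtain ⟨K, hK, x, hx⟩ := exists_mul_self_apply_ne_zero hdim hirr
    rw [hfr K hK inferInstance] at hx
    exact hx rfl
  obtain ⟨e, he, hee, he0⟩ :=
    exists_idempotent_mem_compactMultiplicationPairs hdim hJ hcompact hirr
  obtain ⟨c, d, hc, hd, hcd, v, hv, ν, hν, hdv⟩ :=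
    exists_eigenvector_of_mem_compactMultiplicationPairs hX he hee he0
  obtain ⟨U, hU, hvU, hinv⟩ := exists_finiteDimensional_invariant hJ
    (exists_finiteDimensional_orbit hclosed hfr hc hd hcd hν hdv)
  rcases hirr U (Submodule.closed_of_finiteDimensional _) hinv with h | h
  · exact hv ((Submodule.mem_bot ℂ).1 (h ▸ hvU))
  · subst h
    exact hX (Submodule.topEquiv.finiteDimensional)

end IrreducibleCase

/-- A uniformly closed Jordan algebra of compact operators (on a space of dimension
at least 2) containing no nonzero finite-rank nilpotent element is reducible. -/
theorem jordan_algebra_no_finite_rank_nilpotent_reducible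
    {X : Type*} [NormedAddCommGroup X] [NormedSpace ℂ X] [CompleteSpace X]
    (hdim : 2 ≤ Module.rank ℂ X)
    (J : Submodule ℂ (X →L[ℂ] X))
    (hclosed : IsClosed (J : Set (X →L[ℂ] X)))
    (hJordan : ∀ A ∈ J, ∀ B ∈ J, A * B + B * A ∈ J)
    (hcompact : ∀ A ∈ J, IsCompactOperator A)
    (hfr : ∀ F ∈ J, FiniteDimensional ℂ (LinearMap.range (F : X →ₗ[ℂ] X)) →
      (∃ k : ℕ, 1 ≤ k ∧ F ^ k = 0) → F = 0) :
    ∃ M : Submodule ℂ X, IsClosed (M : Set X) ∧ M ≠ ⊥ ∧ M ≠ ⊤ ∧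
      ∀ A ∈ J, ∀ x ∈ M, A x ∈ M := by
  by_contra! hred
  have hirr : ∀ M : Submodule ℂ X, IsClosed (M : Set X) → (∀ A ∈ J, ∀ x ∈ M, A x ∈ M) →
      M = ⊥ ∨ M = ⊤ := by
    intro M hM hinv
    by_contra! h
    obtain ⟨A, hA, x, hx, hAx⟩ := hred M hM h.1 h.2
    exact hAx (hinv A hA x hx)
  obtain ⟨M, hM, h0, h1, hinv⟩ := exists_invariant_of_finiteRank hdim hJordan
    (fun F hF hfin n hn => hfr F hF hfin ⟨n + 1, Nat.le_add_left 1 n, hn⟩)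
    (exists_finiteRank_of_irreducible hdim hclosed hJordan hcompact hirr)
  exact (hirr M hM hinv).elim h0 h1
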